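/- arXiv:2411.12323 — 8 statements merged into one kernel-verified Lean document; each statement's English description precedes it below -/
import Mathlib

section
/- Under the stated assumptions, the function Γ_g is strictly convex on (0,∞)^d and admits a unique minimizer y* ∈ (0,∞)^d, which satisfies ∇Γ_g(y*) = 0. Moreover, u* := y*/‖y*‖₁ lies in the open simplex Δ_d^{>0} = {u ∈ (0,∞)^d : Σ_i u_i = 1} and satisfies the risk-budgeting equations u*_i ∂_{u_i} r(u*) = b_i r(u*) for every i = 1,…,d; conversely, any u ∈ Δ_d^{>0} satisfying these equations equals u*. -/
open scoped BigOperators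
open Set

section Orthant

variable {ι : Type*}

theorem convex_setOf_forall_pos : Convex ℝ {y : ι → ℝ | ∀ i, 0 < y i} := by
  intro x hx y hy a c ha hc hac i
  have hxi := hx i
  have hyi := hy i
  simp only [Pi.add_apply, Pi.smul_apply, smul_eq_mul]
  rcases ha.lt_or_eq with h | h
  · have := mul_pos h hxi
    have := mul_nonneg hc hyi.le
    linarith
  · subst h
    have : c = 1 := by linarith
    subst this
    simpa using hyi

theorem isOpen_setOf_forall_pos [Finite ι] : IsOpen {y : ι → ℝ | ∀ i, 0 < y i} := by
  simp only [ofPred_forall]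
  exact isOpen_iInter_of_finite fun i => isOpen_lt continuous_const (continuous_apply i)

/-- A sublinear function on the nonnegative orthant is convex on the open orthant. -/
theorem convexOn_of_sublinear {r : (ι → ℝ) → ℝ}
    (hom : ∀ c : ℝ, 0 ≤ c → ∀ y : ι → ℝ, (∀ i, 0 ≤ y i) → r (c • y) = c * r y)
    (sub : ∀ y y' : ι → ℝ, (∀ i, 0 ≤ y i) → (∀ i, 0 ≤ y' i) → r (y + y') ≤ r y + r y') :
    ConvexOn ℝ {y : ι → ℝ | ∀ i, 0 < y i} r := by
  refine ⟨convex_setOf_forall_pos, fun x hx y hy a c ha hc _ => ?_⟩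
  have h := sub (a • x) (c • y) (fun i => mul_nonneg ha (hx i).le)
    (fun i => mul_nonneg hc (hy i).le)
  rwa [hom a ha x fun i => (hx i).le, hom c hc y fun i => (hy i).le] at h

variable [Fintype ι]

theorem strictConcaveOn_sum_mul_log {b : ι → ℝ} (hb : ∀ i, 0 < b i) :
    StrictConcaveOn ℝ {y : ι → ℝ | ∀ i, 0 < y i} fun y => ∑ i, b i * Real.log (y i) := by
  refine ⟨convex_setOf_forall_pos, fun x hx y hy hxy a c ha hc hac => ?_⟩
  obtain ⟨j, hj⟩ := Function.ne_iff.mp hxy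
  simp only [smul_eq_mul, Finset.mul_sum, ← Finset.sum_add_distrib, Pi.add_apply, Pi.smul_apply]
  refine Finset.sum_lt_sum (fun i _ => ?_) ⟨j, Finset.mem_univ j, ?_⟩
  · have h := strictConcaveOn_log_Ioi.concaveOn.2 (hx i) (hy i) ha.le hc.le hac
    simp only [smul_eq_mul] at h
    linarith [mul_le_mul_of_nonneg_left h (hb i).le]
  · have h := strictConcaveOn_log_Ioi.2 (hx j) (hy j) hj ha hc hac
    simp only [smul_eq_mul] at h
    linarith [mul_lt_mul_of_pos_left h (hb j)]

theorem sum_smul_proj_apply (v x : ι → ℝ) :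
    (∑ i, v i • (ContinuousLinearMap.proj i : (ι → ℝ) →L[ℝ] ℝ)) x = ∑ i, v i * x i := by
  simp

theorem sum_smul_proj_injective {v w : ι → ℝ}
    (h : ∑ i, v i • (ContinuousLinearMap.proj i : (ι → ℝ) →L[ℝ] ℝ) =
      ∑ i, w i • (ContinuousLinearMap.proj i : (ι → ℝ) →L[ℝ] ℝ)) : v = w := by
  classical
  funext j
  have := congrArg (fun L : (ι → ℝ) →L[ℝ] ℝ => L (Pi.single j 1)) h
  simpa only [sum_smul_proj_apply, Pi.single_apply, mul_ite, mul_one, mul_zero,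
    Finset.sum_ite_eq', Finset.mem_univ, if_true] using this

/-- Euler's identity for positively homogeneous functions of degree one. -/
theorem sum_mul_grad_eq_of_homogeneous {r : (ι → ℝ) → ℝ} {v y : ι → ℝ}
    (hom : ∀ c : ℝ, 0 ≤ c → r (c • y) = c * r y)
    (hd : HasFDerivAt r (∑ i, v i • (ContinuousLinearMap.proj i : (ι → ℝ) →L[ℝ] ℝ)) y) :
    ∑ i, v i * y i = r y := by
  have h1 : HasDerivAt (fun c : ℝ => c • y) y 1 := by
    simpa using (hasDerivAt_id (1 : ℝ)).smul_const y
  have h2 : HasDerivAt (fun c : ℝ => r (c • y)) (∑ i, v i * y i) 1 := by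
    rw [← sum_smul_proj_apply]
    exact HasFDerivAt.comp_hasDerivAt (1 : ℝ) (by simpa using hd) h1
  have h3 : HasDerivAt (fun c : ℝ => r (c • y)) (r y) 1 := by
    have h4 : HasDerivAt (fun c : ℝ => c * r y) (r y) 1 := by
      simpa using (hasDerivAt_id (1 : ℝ)).mul_const (r y)
    refine h4.congr_of_eventuallyEq ?_
    filter_upwards [lt_mem_nhds (zero_lt_one' ℝ)] with c hc using hom c hc.le
  exact h2.unique h3

/-- The gradient of a positively homogeneous function of degree one is invariant under
positive dilations. -/
theorem grad_smul_eq_of_homogeneous {r : (ι → ℝ) → ℝ} {G : (ι → ℝ) → ι → ℝ}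
    (hom : ∀ c : ℝ, 0 ≤ c → ∀ y : ι → ℝ, (∀ i, 0 ≤ y i) → r (c • y) = c * r y)
    (hd : ∀ y : ι → ℝ, (∀ i, 0 < y i) →
      HasFDerivAt r (∑ i, G y i • (ContinuousLinearMap.proj i : (ι → ℝ) →L[ℝ] ℝ)) y)
    {c : ℝ} (hc : 0 < c) {y : ι → ℝ} (hy : ∀ i, 0 < y i) : G (c • y) = G y := by
  have h1 : HasFDerivAt (fun x : ι → ℝ => c • x) (c • ContinuousLinearMap.id ℝ (ι → ℝ)) y :=
    (hasFDerivAt_id y).const_smul c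
  have h2 := (hd (c • y) fun i => mul_pos hc (hy i)).comp y h1
  have h3 : HasFDerivAt (r ∘ fun x : ι → ℝ => c • x)
      (c • ∑ i, G y i • (ContinuousLinearMap.proj i : (ι → ℝ) →L[ℝ] ℝ)) y := by
    refine ((hd y hy).const_smul c).congr_of_eventuallyEq ?_
    filter_upwards [isOpen_setOf_forall_pos.mem_nhds hy] with x hx
    exact hom c hc.le x fun i => (hx i).le
  have h4 := h2.unique h3
  apply sum_smul_proj_injective
  ext1 x
  have h5 := congrArg (fun L : (ι → ℝ) →L[ℝ] ℝ => L x) h4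
  simp only [ContinuousLinearMap.comp_apply, smul_apply,
    ContinuousLinearMap.id_apply, map_smul, smul_eq_mul] at h5
  exact mul_left_cancel₀ hc.ne' h5

theorem hasFDerivAt_comp_sub_sum_mul_log {r : (ι → ℝ) → ℝ} {g : ℝ → ℝ} {g' : ℝ} {b v y : ι → ℝ}
    (hr : HasFDerivAt r (∑ i, v i • (ContinuousLinearMap.proj i : (ι → ℝ) →L[ℝ] ℝ)) y)
    (hg : HasDerivAt g g' (r y)) (hy : ∀ i, 0 < y i) :
    HasFDerivAt (fun y => g (r y) - ∑ i, b i * Real.log (y i))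
      (∑ i, (g' * v i - b i / y i) • (ContinuousLinearMap.proj i : (ι → ℝ) →L[ℝ] ℝ)) y := by
  have h1 := hg.comp_hasFDerivAt y hr
  have h2 : HasFDerivAt (fun y : ι → ℝ => ∑ i, b i * Real.log (y i))
      (∑ i, b i • (y i)⁻¹ • (ContinuousLinearMap.proj i : (ι → ℝ) →L[ℝ] ℝ)) y :=
    HasFDerivAt.fun_sum fun i _ =>
      ((hasFDerivAt_apply i y).log (hy i).ne').const_mul (b i)
  refine (h1.sub h2).congr_fderiv ?_
  simp only [Finset.smul_sum, smul_smul, ← Finset.sum_sub_distrib, ← sub_smul, div_eq_mul_inv]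

/-- A continuous positively homogeneous function that is positive on the simplex dominates a
positive multiple of the sum of the coordinates. -/
theorem exists_pos_mul_sum_le [Nonempty ι] {r : (ι → ℝ) → ℝ}
    (cont : ContinuousOn r {y : ι → ℝ | ∀ i, 0 ≤ y i})
    (hom : ∀ c : ℝ, 0 ≤ c → ∀ y : ι → ℝ, (∀ i, 0 ≤ y i) → r (c • y) = c * r y)
    (pos : ∀ u : ι → ℝ, (∀ i, 0 ≤ u i) → ∑ i, u i = 1 → 0 < r u) :
    ∃ m : ℝ, 0 < m ∧ ∀ y : ι → ℝ, (∀ i, 0 < y i) → m * ∑ i, y i ≤ r y := by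
  classical
  obtain ⟨u, hu, hmin⟩ := (isCompact_stdSimplex ℝ ι).exists_isMinOn
    ⟨_, single_mem_stdSimplex ℝ (Classical.arbitrary ι)⟩ (cont.mono fun y hy => hy.1)
  refine ⟨r u, pos u hu.1 hu.2, fun y hy => ?_⟩
  have hS : 0 < ∑ i, y i := Finset.sum_pos (fun i _ => hy i) Finset.univ_nonempty
  have hmem : (∑ i, y i)⁻¹ • y ∈ stdSimplex ℝ ι := by
    refine ⟨fun i => (mul_pos (inv_pos.2 hS) (hy i)).le, ?_⟩
    simp only [Pi.smul_apply, smul_eq_mul, ← Finset.mul_sum]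
    exact inv_mul_cancel₀ hS.ne'
  have h : r u ≤ r ((∑ i, y i)⁻¹ • y) := hmin hmem
  rw [hom _ (inv_pos.2 hS).le y fun i => (hy i).le, inv_mul_eq_div, le_div_iff₀ hS] at h
  exact h

end Orthant

theorem ConvexOn.add_mul_sub_one_le {g : ℝ → ℝ} (hg : ConvexOn ℝ (Ici 0) g)
    (hmono : StrictMonoOn g (Ici 0)) {x : ℝ} (hx : 0 ≤ x) :
    g 0 + (g 1 - g 0) * (x - 1) ≤ g x := by
  have h0 : (0 : ℝ) ∈ Ici (0 : ℝ) := self_mem_Ici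
  have h1 : (1 : ℝ) ∈ Ici (0 : ℝ) := zero_le_one' ℝ
  have h01 : g 0 < g 1 := hmono h0 h1 zero_lt_one
  rcases le_or_gt x 1 with h | h
  · have := hmono.monotoneOn h0 hx hx
    nlinarith
  · have := hg.slope_mono_adjacent h0 hx zero_lt_one h
    rw [sub_zero, div_one, le_div_iff₀ (by linarith)] at this
    linarith

theorem ConvexOn.isMinOn_of_hasFDerivAt_eq_zero {E : Type*} [NormedAddCommGroup E]
    [NormedSpace ℝ E] {s : Set E} {f : E → ℝ} (hf : ConvexOn ℝ s f) {x : E} (hx : x ∈ s)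
    (hd : HasFDerivAt f (0 : E →L[ℝ] ℝ) x) : IsMinOn f s x := by
  intro y hy
  have hconv : ConvexOn ℝ (AffineMap.lineMap x y ⁻¹' s) (f ∘ AffineMap.lineMap (k := ℝ) x y) :=
    hf.comp_affineMap _
  have hder : HasDerivAt (f ∘ AffineMap.lineMap (k := ℝ) x y) 0 0 := by
    have h := HasFDerivAt.comp_hasDerivAt (0 : ℝ) (f := AffineMap.lineMap (k := ℝ) x y)
      (by simpa using hd) AffineMap.hasDerivAt_lineMap
    simpa using h
  have h := hconv.le_slope_of_hasDerivAt (x := 0) (y := 1) (by simpa using hx) (by simpa using hy)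
    zero_lt_one hder
  simpa [slope_def_field] using h

/-- Existence of a minimizer on the open orthant for a linearly coercive function penalized by a
logarithmic barrier. -/
theorem exists_isMinOn_sub_sum_mul_log {ι : Type*} [Fintype ι] {b : ι → ℝ} (hb : ∀ i, 0 < b i)
    (hbsum : ∑ i, b i = 1) {h : (ι → ℝ) → ℝ} {A k : ℝ} (hk : 0 < k)
    (hlow : ∀ y : ι → ℝ, (∀ i, 0 < y i) → A + k * ∑ i, y i ≤ h y)
    (hcont : ContinuousOn h {y : ι → ℝ | ∀ i, 0 < y i}) :
    ∃ y : ι → ℝ, (∀ i, 0 < y i) ∧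
      IsMinOn (fun y => h y - ∑ i, b i * Real.log (y i)) {y : ι → ℝ | ∀ i, 0 < y i} y := by
  set F : (ι → ℝ) → ℝ := fun y => h y - ∑ i, b i * Real.log (y i) with hF
  have hb1 : ∀ i, b i ≤ 1 := fun i => by
    rw [← hbsum]
    exact Finset.single_le_sum (fun j _ => (hb j).le) (Finset.mem_univ i)
  have hFcont : ContinuousOn F {y : ι → ℝ | ∀ i, 0 < y i} :=
    hcont.sub <| continuousOn_finsetSum _ fun i _ =>
      continuousOn_const.mul <| (continuous_apply i).continuousOn.log fun y hy => (hy i).ne'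
  have hlog : ∀ t : ℝ, 0 < t → Real.log t ≤ k / 2 * t - Real.log (k / 2) := fun t ht => by
    have h1 := Real.log_le_sub_one_of_pos (mul_pos (half_pos hk) ht)
    rw [Real.log_mul (half_pos hk).ne' ht.ne'] at h1
    linarith
  obtain ⟨M, hM1, hM⟩ : ∃ M : ℝ, 1 ≤ M ∧ ∀ y : ι → ℝ, (∀ i, 0 < y i) → F y ≤ F 1 →
      ∀ i, y i ≤ M := by
    refine ⟨max 1 ((F 1 - A - Real.log (k / 2)) / (k / 2)), le_max_left _ _,
      fun y hy hFy i => le_max_of_le_right ?_⟩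
    rw [le_div_iff₀ (half_pos hk)]
    have h1 : ∑ i, b i * Real.log (y i) ≤ k / 2 * ∑ i, y i - Real.log (k / 2) := by
      calc ∑ i, b i * Real.log (y i)
          ≤ ∑ i, (k / 2 * y i - b i * Real.log (k / 2)) := Finset.sum_le_sum fun i _ => by
            have h2 := mul_le_mul_of_nonneg_left (hlog (y i) (hy i)) (hb i).le
            have h3 := mul_le_mul_of_nonneg_right (hb1 i) (mul_pos (half_pos hk) (hy i)).le
            linarith
        _ = k / 2 * ∑ i, y i - Real.log (k / 2) := by
            rw [Finset.sum_sub_distrib, ← Finset.mul_sum, ← Finset.sum_mul, hbsum, one_mul]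
    have h2 : y i ≤ ∑ i, y i := Finset.single_le_sum (fun j _ => (hy j).le) (Finset.mem_univ i)
    have h3 := hlow y hy
    have h4 := mul_le_mul_of_nonneg_left h2 (half_pos hk).le
    simp only [hF] at hFy ⊢
    linarith
  have hlo : ∀ y : ι → ℝ, (∀ i, 0 < y i) → F y ≤ F 1 →
      ∀ i, Real.exp ((A - F 1 - Real.log M) / b i) ≤ y i := by
    intro y hy hFy i
    rw [← Real.le_log_iff_exp_le (hy i), div_le_iff₀ (hb i)]
    have hS : 0 ≤ k * ∑ i, y i := mul_nonneg hk.le (Finset.sum_nonneg fun j _ => (hy j).le)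
    have h3 := hlow y hy
    have hlogM : 0 ≤ Real.log M := Real.log_nonneg hM1
    have h1 : ∑ j, b j * Real.log (y j) ≤ b i * Real.log (y i) + Real.log M := by
      classical
      rw [← Finset.add_sum_erase _ _ (Finset.mem_univ i)]
      gcongr
      calc ∑ j ∈ Finset.univ.erase i, b j * Real.log (y j)
          ≤ ∑ j ∈ Finset.univ.erase i, b j * Real.log M := Finset.sum_le_sum fun j _ =>
            mul_le_mul_of_nonneg_left (Real.log_le_log (hy j) (hM y hy hFy j)) (hb j).le
        _ ≤ ∑ j, b j * Real.log M := Finset.sum_le_sum_of_subset_of_nonneg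
            (Finset.erase_subset _ _) fun j _ _ => mul_nonneg (hb j).le hlogM
        _ = Real.log M := by rw [← Finset.sum_mul, hbsum, one_mul]
    have h5 : h y - ∑ i, b i * Real.log (y i) ≤ F 1 := hFy
    linarith
  set lo : ι → ℝ := fun i => Real.exp ((A - F 1 - Real.log M) / b i)
  have hsub : Icc lo (fun _ => M) ⊆ {y : ι → ℝ | ∀ i, 0 < y i} := fun y hy i =>
    (Real.exp_pos _).trans_le (hy.1 i)
  have hone : (1 : ι → ℝ) ∈ Icc lo (fun _ => M) :=
    ⟨hlo 1 (fun _ => one_pos) le_rfl, hM 1 (fun _ => one_pos) le_rfl⟩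
  obtain ⟨x, hx, hmin⟩ := isCompact_Icc.exists_isMinOn ⟨1, hone⟩ (hFcont.mono hsub)
  refine ⟨x, hsub hx, fun y hy => ?_⟩
  rcases le_total (F y) (F 1) with h1 | h1
  · exact hmin ⟨hlo y hy h1, hM y hy h1⟩
  · exact (hmin hone).trans h1

/-- Under positive homogeneity, subadditivity, positivity on the simplex and
regularity of the risk map `r`, and convexity/monotonicity/regularity of `g`, the function
`Γ_g(y) = g(r y) - ∑ i, b i * log (y i)` is strictly convex on the open orthant, has a unique
minimizer `y*` there with vanishing gradient, and `u* = y*/‖y*‖₁` is the unique solution in the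
open simplex of the risk budgeting equations `u i * ∂_i r u = b i * r u`. -/
theorem riskBudgeting_existence_uniqueness
    (d : ℕ) (hd : 1 ≤ d)
    (b : Fin d → ℝ) (hb : ∀ i, 0 < b i) (hbsum : ∑ i, b i = 1)
    (r : (Fin d → ℝ) → ℝ) (rGrad : (Fin d → ℝ) → Fin d → ℝ)
    (g : ℝ → ℝ) (gDeriv : ℝ → ℝ)
    (hr_cont : ContinuousOn r {y : Fin d → ℝ | ∀ i, 0 ≤ y i})
    (hr_diff : ∀ y : Fin d → ℝ, (∀ i, 0 < y i) →
      HasFDerivAt r (∑ i, rGrad y i • (ContinuousLinearMap.proj i : (Fin d → ℝ) →L[ℝ] ℝ)) y)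
    (hrGrad_cont : ContinuousOn rGrad {y : Fin d → ℝ | ∀ i, 0 < y i})
    (hr_hom : ∀ c : ℝ, 0 ≤ c → ∀ y : Fin d → ℝ, (∀ i, 0 ≤ y i) → r (c • y) = c * r y)
    (hr_sub : ∀ y y' : Fin d → ℝ, (∀ i, 0 ≤ y i) → (∀ i, 0 ≤ y' i) →
      r (y + y') ≤ r y + r y')
    (hr_pos : ∀ u : Fin d → ℝ, (∀ i, 0 ≤ u i) → ∑ i, u i = 1 → 0 < r u)
    (hg_diff : ∀ x : ℝ, 0 ≤ x → HasDerivAt g (gDeriv x) x)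
    (hgDeriv_cont : ContinuousOn gDeriv (Ici (0 : ℝ)))
    (hg_conv : ConvexOn ℝ (Ici (0 : ℝ)) g)
    (hg_mono : StrictMonoOn g (Ici (0 : ℝ))) :
    StrictConvexOn ℝ {y : Fin d → ℝ | ∀ i, 0 < y i}
      (fun y => g (r y) - ∑ i, b i * Real.log (y i)) ∧
    ∃ ystar : Fin d → ℝ, (∀ i, 0 < ystar i) ∧
      IsMinOn (fun y => g (r y) - ∑ i, b i * Real.log (y i))
        {y : Fin d → ℝ | ∀ i, 0 < y i} ystar ∧
      (∀ y : Fin d → ℝ, (∀ i, 0 < y i) →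
        IsMinOn (fun y => g (r y) - ∑ i, b i * Real.log (y i))
          {y : Fin d → ℝ | ∀ i, 0 < y i} y → y = ystar) ∧
      (∀ i, gDeriv (r ystar) * rGrad ystar i - b i / ystar i = 0) ∧
      (∀ i, 0 < (∑ j, ystar j)⁻¹ * ystar i) ∧
      (∑ i, (∑ j, ystar j)⁻¹ * ystar i) = 1 ∧
      (∀ i, ((∑ j, ystar j)⁻¹ * ystar i) * rGrad ((∑ j, ystar j)⁻¹ • ystar) i
          = b i * r ((∑ j, ystar j)⁻¹ • ystar)) ∧
      (∀ u : Fin d → ℝ, (∀ i, 0 < u i) → ∑ i, u i = 1 →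
        (∀ i, u i * rGrad u i = b i * r u) → u = (∑ j, ystar j)⁻¹ • ystar) := by
  set Γ : (Fin d → ℝ) → ℝ := fun y => g (r y) - ∑ i, b i * Real.log (y i)
  have : Nonempty (Fin d) := ⟨⟨0, hd⟩⟩
  obtain ⟨m, hm, hmle⟩ := exists_pos_mul_sum_le hr_cont hr_hom hr_pos
  have hsum_pos : ∀ y : Fin d → ℝ, (∀ i, 0 < y i) → 0 < ∑ i, y i := fun y hy =>
    Finset.sum_pos (fun i _ => hy i) Finset.univ_nonempty
  have hrpos : ∀ y : Fin d → ℝ, (∀ i, 0 < y i) → 0 < r y := fun y hy =>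
    (mul_pos hm (hsum_pos y hy)).trans_le (hmle y hy)
  have hr_conv := convexOn_of_sublinear hr_hom hr_sub
  have hgr_conv : ConvexOn ℝ {y : Fin d → ℝ | ∀ i, 0 < y i} fun y => g (r y) := by
    refine ⟨convex_setOf_forall_pos, fun x hx y hy a c ha hc hac => ?_⟩
    have hxy := convex_setOf_forall_pos hx hy ha hc hac
    have hrx : r x ∈ Ici (0 : ℝ) := (hrpos x hx).le
    have hry : r y ∈ Ici (0 : ℝ) := (hrpos y hy).le
    exact (hg_mono.monotoneOn (hrpos _ hxy).le (convex_Ici 0 hrx hry ha hc hac)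
      (hr_conv.2 hx hy ha hc hac)).trans (hg_conv.2 hrx hry ha hc hac)
  have hstrict : StrictConvexOn ℝ {y : Fin d → ℝ | ∀ i, 0 < y i} Γ :=
    hgr_conv.sub_strictConcaveOn (strictConcaveOn_sum_mul_log hb)
  have hder : ∀ y : Fin d → ℝ, (∀ i, 0 < y i) → HasFDerivAt Γ
      (∑ i, (gDeriv (r y) * rGrad y i - b i / y i) •
        (ContinuousLinearMap.proj i : (Fin d → ℝ) →L[ℝ] ℝ)) y := fun y hy =>
    hasFDerivAt_comp_sub_sum_mul_log (hr_diff y hy) (hg_diff _ (hrpos y hy).le) hy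
  have hg01 : 0 < g 1 - g 0 :=
    sub_pos.2 (hg_mono self_mem_Ici (zero_le_one' ℝ) zero_lt_one)
  obtain ⟨y, hy, hmin⟩ := exists_isMinOn_sub_sum_mul_log hb hbsum (h := fun y => g (r y))
    (A := g 0 - (g 1 - g 0)) (mul_pos hg01 hm)
    (fun y hy => by
      have h1 := hg_conv.add_mul_sub_one_le hg_mono (hrpos y hy).le
      have h2 := mul_le_mul_of_nonneg_left (hmle y hy) hg01.le
      linarith)
    (fun y hy => ((hg_diff _ (hrpos y hy).le).continuousAt.comp
      (hr_diff y hy).continuousAt).continuousWithinAt)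
  have huniq : ∀ z : Fin d → ℝ, (∀ i, 0 < z i) →
      IsMinOn Γ {y : Fin d → ℝ | ∀ i, 0 < y i} z → z = y := fun z hz hzmin =>
    hstrict.eq_of_isMinOn hzmin hmin hz hy
  have hgrad : ∀ i, gDeriv (r y) * rGrad y i - b i / y i = 0 := by
    have h := (hmin.isLocalMin (isOpen_setOf_forall_pos.mem_nhds hy)).hasFDerivAt_eq_zero
      (hder y hy)
    exact congrFun (sum_smul_proj_injective (w := 0) (by simpa using h))
  have hbudget : ∀ i, gDeriv (r y) * (rGrad y i * y i) = b i := fun i => by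
    have h := sub_eq_zero.1 (hgrad i)
    rw [eq_div_iff (hy i).ne'] at h
    linarith
  have hone : gDeriv (r y) * r y = 1 := by
    have heuler := sum_mul_grad_eq_of_homogeneous
      (fun c hc => hr_hom c hc y fun i => (hy i).le) (hr_diff y hy)
    calc gDeriv (r y) * r y = gDeriv (r y) * ∑ i, rGrad y i * y i := by rw [heuler]
      _ = 1 := by rw [Finset.mul_sum, Finset.sum_congr rfl fun i _ => hbudget i, hbsum]
  have hS := hsum_pos y hy
  have hSinv := inv_pos.2 hS
  refine ⟨hstrict, y, hy, hmin, huniq, hgrad, fun i => mul_pos hSinv (hy i), ?_, fun i => ?_,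
    fun u hu husum hueq => ?_⟩
  · rw [← Finset.mul_sum, inv_mul_cancel₀ hS.ne']
  · rw [grad_smul_eq_of_homogeneous hr_hom hr_diff hSinv hy,
      hr_hom _ hSinv.le y fun i => (hy i).le, ← hbudget i]
    linear_combination (-(∑ j, y j)⁻¹ * y i * rGrad y i) * hone
  · have hru := hrpos u hu
    set t := r y / r u with ht
    have htpos : 0 < t := div_pos (hrpos y hy) hru
    have htu : ∀ i, 0 < (t • u) i := fun i => mul_pos htpos (hu i)
    have hrtu : r (t • u) = r y := by
      rw [hr_hom t htpos.le u fun i => (hu i).le, ht, div_mul_cancel₀ _ hru.ne']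
    have hcrit : HasFDerivAt Γ (0 : (Fin d → ℝ) →L[ℝ] ℝ) (t • u) := by
      refine (hder _ htu).congr_fderiv (Finset.sum_eq_zero fun i _ => ?_)
      have h : gDeriv (r y) * rGrad u i - b i / (t * u i) = 0 := by
        rw [sub_eq_zero, eq_div_iff (mul_pos htpos (hu i)).ne']
        have h1 : t * r u = r y := div_mul_cancel₀ _ hru.ne'
        linear_combination gDeriv (r y) * t * hueq i + gDeriv (r y) * b i * h1 + b i * hone
      rw [grad_smul_eq_of_homogeneous hr_hom hr_diff htpos hu, hrtu, Pi.smul_apply, smul_eq_mul,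
        h, zero_smul]
    have heq := huniq _ htu (hstrict.convexOn.isMinOn_of_hasFDerivAt_eq_zero htu hcrit)
    have hsum : ∑ j, y j = t := by
      rw [← heq]
      simp only [Pi.smul_apply, smul_eq_mul, ← Finset.mul_sum, husum, mul_one]
    rw [hsum, ← heq, smul_smul, inv_mul_cancel₀ htpos.ne', one_smul]
end

section
/- For every y ∈ ℝ_+^d with y ≠ y*, one has ⟨y − y*, T(y)⟩ > 0, where y* ∈ (0,∞)^d is the unique minimizer of Γ_g and T is the tamed gradient. -/
open scoped BigOperators Classical
open Set

noncomputable section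

/-- The tamed gradient `T` of `Γ_g`: on the open orthant it equals `κ(y) ∇Γ_g(y)` with
`κ(y) = min(min_i y_i, 1)`, and at a boundary point `T_j(y) = -b j` if `y j = 0`, else `0`. -/
def tamedGrad (d : ℕ) (b : Fin d → ℝ) (r : (Fin d → ℝ) → ℝ)
    (rGrad : (Fin d → ℝ) → Fin d → ℝ) (gDeriv : ℝ → ℝ) (y : Fin d → ℝ) : Fin d → ℝ :=
  fun j =>
    if ∀ i, 0 < y i then
      min (⨅ i, y i) 1 * (gDeriv (r y) * rGrad y j) - b j * min (⨅ i, y i) 1 / y j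
    else if y j = 0 then -b j else 0

/-- The subgradient inequality for a convex function that is differentiable at a point. -/
theorem ConvexOn.hasFDerivAt_apply_sub_le {E : Type*} [NormedAddCommGroup E] [NormedSpace ℝ E]
    {s : Set E} {f : E → ℝ} {f' : E →L[ℝ] ℝ} {x y : E} (hf : ConvexOn ℝ s f)
    (hx : x ∈ s) (hy : y ∈ s) (hd : HasFDerivAt f f' x) : f' (y - x) ≤ f y - f x := by
  have hconv : ConvexOn ℝ (AffineMap.lineMap x y ⁻¹' s) (f ∘ AffineMap.lineMap (k := ℝ) x y) :=
    hf.comp_affineMap _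
  have hderiv : HasDerivAt (f ∘ AffineMap.lineMap (k := ℝ) x y) (f' (y - x)) 0 := by
    refine HasFDerivAt.comp_hasDerivAt (0 : ℝ) ?_ AffineMap.hasDerivAt_lineMap
    simpa using hd
  have h := hconv.le_slope_of_hasDerivAt (x := 0) (y := 1) (by simpa using hx) (by simpa using hy)
    one_pos hderiv
  simpa [slope_def_field] using h

/-- The subgradient inequality for a convex function of one real variable. -/
theorem ConvexOn.deriv_mul_sub_le {s : Set ℝ} {f : ℝ → ℝ} {f' x y : ℝ} (hf : ConvexOn ℝ s f)
    (hx : x ∈ s) (hy : y ∈ s) (hd : HasDerivAt f f' x) : f' * (y - x) ≤ f y - f x := by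
  simpa [mul_comm] using hf.hasFDerivAt_apply_sub_le hx hy hd.hasFDerivAt

/-- A positively homogeneous subadditive function is convex on the nonnegative orthant. -/
theorem convexOn_orthant_of_subadditive {ι : Type*} {r : (ι → ℝ) → ℝ}
    (hom : ∀ c : ℝ, 0 ≤ c → ∀ y : ι → ℝ, (∀ i, 0 ≤ y i) → r (c • y) = c * r y)
    (sub : ∀ y y' : ι → ℝ, (∀ i, 0 ≤ y i) → (∀ i, 0 ≤ y' i) → r (y + y') ≤ r y + r y') :
    ConvexOn ℝ {y : ι → ℝ | ∀ i, 0 ≤ y i} r := by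
  refine ⟨convex_Ici (0 : ι → ℝ), fun x hx y hy a c ha hc _ => ?_⟩
  rw [smul_eq_mul, smul_eq_mul, ← hom a ha x hx, ← hom c hc y hy]
  exact sub _ _ (fun i => mul_nonneg ha (hx i)) (fun i => mul_nonneg hc (hy i))

/-- A positively homogeneous function that is positive on the simplex is positive at every
nonzero point of the orthant. -/
theorem pos_of_homogeneous_of_pos_simplex {ι : Type*} [Fintype ι] {r : (ι → ℝ) → ℝ}
    (hom : ∀ c : ℝ, 0 ≤ c → ∀ y : ι → ℝ, (∀ i, 0 ≤ y i) → r (c • y) = c * r y)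
    (pos : ∀ u : ι → ℝ, (∀ i, 0 ≤ u i) → ∑ i, u i = 1 → 0 < r u)
    {y : ι → ℝ} (hy : ∀ i, 0 ≤ y i) (hsum : 0 < ∑ i, y i) : 0 < r y := by
  have h := pos ((∑ i, y i)⁻¹ • y) (fun i => mul_nonneg (inv_nonneg.2 hsum.le) (hy i))
    (by simp [← Finset.mul_sum, hsum.ne'])
  rw [hom _ (inv_nonneg.2 hsum.le) y hy] at h
  exact (pos_iff_pos_of_mul_pos h).1 (inv_pos.2 hsum)

/-- The gradient of minus the weighted sum of logarithms is strictly monotone. -/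
theorem sum_mul_div_sub_div_pos {ι : Type*} [Fintype ι] {b x y : ι → ℝ} (hb : ∀ i, 0 < b i)
    (hx : ∀ i, 0 < x i) (hy : ∀ i, 0 < y i) (hne : y ≠ x) :
    0 < ∑ i, (y i - x i) * (b i / x i - b i / y i) := by
  have key : ∀ i, (y i - x i) * (b i / x i - b i / y i) =
      b i * (y i - x i) ^ 2 / (x i * y i) := fun i => by
    have := (hx i).ne'
    have := (hy i).ne'
    field_simp
  simp only [key]
  obtain ⟨j, hj⟩ := Function.ne_iff.1 hne
  refine Finset.sum_pos' (fun i _ => ?_) ⟨j, Finset.mem_univ j, ?_⟩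
  · have := hb i
    have := hx i
    have := hy i
    positivity
  · have := hb j
    have := mul_pos (hx j) (hy j)
    have := sq_pos_of_ne_zero (sub_ne_zero.2 hj)
    positivity

/-- Lemma 2.2 of the paper. For every `y` in the nonnegative orthant with
`y ≠ y*`, one has `⟨y - y*, T(y)⟩ > 0`, where `y*` is the unique minimizer of `Γ_g`. -/
theorem tamedGrad_mean_reverting
    (d : ℕ) (hd : 1 ≤ d)
    (b : Fin d → ℝ) (hb : ∀ i, 0 < b i) (hbsum : ∑ i, b i = 1)
    (r : (Fin d → ℝ) → ℝ) (rGrad : (Fin d → ℝ) → Fin d → ℝ)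
    (g : ℝ → ℝ) (gDeriv : ℝ → ℝ)
    (hr_cont : ContinuousOn r {y : Fin d → ℝ | ∀ i, 0 ≤ y i})
    (hr_diff : ∀ y : Fin d → ℝ, (∀ i, 0 < y i) →
      HasFDerivAt r (∑ i, rGrad y i • (ContinuousLinearMap.proj i : (Fin d → ℝ) →L[ℝ] ℝ)) y)
    (hrGrad_cont : ContinuousOn rGrad {y : Fin d → ℝ | ∀ i, 0 < y i})
    (hr_hom : ∀ c : ℝ, 0 ≤ c → ∀ y : Fin d → ℝ, (∀ i, 0 ≤ y i) → r (c • y) = c * r y)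
    (hr_sub : ∀ y y' : Fin d → ℝ, (∀ i, 0 ≤ y i) → (∀ i, 0 ≤ y' i) →
      r (y + y') ≤ r y + r y')
    (hr_pos : ∀ u : Fin d → ℝ, (∀ i, 0 ≤ u i) → ∑ i, u i = 1 → 0 < r u)
    (hg_diff : ∀ x : ℝ, 0 ≤ x → HasDerivAt g (gDeriv x) x)
    (hgDeriv_cont : ContinuousOn gDeriv (Ici (0 : ℝ)))
    (hg_conv : ConvexOn ℝ (Ici (0 : ℝ)) g)
    (hg_mono : StrictMonoOn g (Ici (0 : ℝ)))
    (ystar : Fin d → ℝ) (hystar_pos : ∀ i, 0 < ystar i)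
    (hystar_min : IsMinOn (fun y => g (r y) - ∑ i, b i * Real.log (y i))
      {y : Fin d → ℝ | ∀ i, 0 < y i} ystar)
    (hystar_unique : ∀ y : Fin d → ℝ, (∀ i, 0 < y i) →
      IsMinOn (fun y => g (r y) - ∑ i, b i * Real.log (y i))
        {y : Fin d → ℝ | ∀ i, 0 < y i} y → y = ystar)
    (hystar_grad : ∀ i, gDeriv (r ystar) * rGrad ystar i - b i / ystar i = 0) :
    ∀ y : Fin d → ℝ, (∀ i, 0 ≤ y i) → y ≠ ystar →
      0 < ∑ i, (y i - ystar i) * tamedGrad d b r rGrad gDeriv y i := by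
  intro y hy hne
  have : Nonempty (Fin d) := ⟨⟨0, hd⟩⟩
  by_cases hpos : ∀ i, 0 < y i
  · have hconv := convexOn_orthant_of_subadditive hr_hom hr_sub
    have hs : ∀ i, 0 ≤ ystar i := fun i => (hystar_pos i).le
    have hry : 0 < r y := pos_of_homogeneous_of_pos_simplex hr_hom hr_pos hy
      (Finset.sum_pos (fun i _ => hpos i) Finset.univ_nonempty)
    have hrs : 0 < r ystar := pos_of_homogeneous_of_pos_simplex hr_hom hr_pos hs
      (Finset.sum_pos (fun i _ => hystar_pos i) Finset.univ_nonempty)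
    have gDeriv_nonneg : ∀ x, 0 < x → 0 ≤ gDeriv x := fun x hx => by
      have h₁ := hg_conv.deriv_mul_sub_le hx.le (mem_Ici.2 le_rfl) (hg_diff x hx.le)
      have h₂ := hg_mono (mem_Ici.2 le_rfl) hx.le hx
      by_contra! h
      nlinarith
    have hgy := hg_conv.deriv_mul_sub_le hry.le hrs.le (hg_diff _ hry.le)
    have hgs := hg_conv.deriv_mul_sub_le hrs.le hry.le (hg_diff _ hrs.le)
    have hsuby := hconv.hasFDerivAt_apply_sub_le hy hs (hr_diff y hpos)
    have hsubs := hconv.hasFDerivAt_apply_sub_le hs hy (hr_diff ystar hystar_pos)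
    simp only [sum_apply, smul_apply,
      ContinuousLinearMap.proj_apply, Pi.sub_apply, smul_eq_mul] at hsuby hsubs
    have hmy := mul_le_mul_of_nonneg_left hsuby (gDeriv_nonneg _ hry)
    have hms := mul_le_mul_of_nonneg_left hsubs (gDeriv_nonneg _ hrs)
    have hlog := sum_mul_div_sub_div_pos hb hystar_pos hpos hne
    have hκ : 0 < min (⨅ i, y i) 1 := by
      obtain ⟨j, hj⟩ := exists_eq_ciInf_of_finite (f := y)
      exact lt_min (hj ▸ hpos j) one_pos
    have hsplit : ∑ i, (y i - ystar i) * tamedGrad d b r rGrad gDeriv y i =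
        min (⨅ i, y i) 1 * (∑ i, (y i - ystar i) * (b i / ystar i - b i / y i)
          - gDeriv (r y) * ∑ i, rGrad y i * (ystar i - y i)
          - gDeriv (r ystar) * ∑ i, rGrad ystar i * (y i - ystar i)) := by
      simp only [tamedGrad, if_pos hpos, Finset.mul_sum, ← Finset.sum_sub_distrib]
      refine Finset.sum_congr rfl fun i _ => ?_
      linear_combination min (⨅ i, y i) 1 * (y i - ystar i) * hystar_grad i
    rw [hsplit]
    exact mul_pos hκ (by linarith)
  · simp only [tamedGrad, if_neg hpos]
    push Not at hpos
    obtain ⟨j, hj⟩ := hpos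
    have hterm : ∀ i, y i = 0 → 0 < (y i - ystar i) * (if y i = 0 then -b i else 0) :=
      fun i hi => by
        rw [if_pos hi, hi]
        nlinarith [mul_pos (hystar_pos i) (hb i)]
    refine Finset.sum_pos' (fun i _ => ?_)
      ⟨j, Finset.mem_univ j, hterm j (le_antisymm hj (hy j))⟩
    by_cases hi : y i = 0
    · exact (hterm i hi).le
    · simp [hi]

end
end

section
/- For every m > 0 and all y ∈ ℝ_+^d, y' ∈ (0,∞)^d with ‖y‖₁ ≤ m and ‖y'‖₁ ≤ m, the Kullback–Leibler divergence satisfies D_F(y, y') ≥ (1/(2m)) ‖y − y'‖₁². -/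
open scoped BigOperators

open InformationTheory

/-- The derivative of `x ↦ (2 * x + 4) * klFun x - 3 * (x - 1) ^ 2` at a nonzero point. -/
lemma hasDerivAt_mul_klFun_sub_sq {x : ℝ} (hx : x ≠ 0) :
    HasDerivAt (fun x : ℝ ↦ (2 * x + 4) * klFun x - 3 * (x - 1) ^ 2)
      (4 * ((x + 1) * Real.log x - 2 * (x - 1))) x := by
  have h1 : HasDerivAt (fun x : ℝ ↦ 2 * x + 4) 2 x := by
    simpa using ((hasDerivAt_id x).const_mul 2).add_const 4
  have h2 : HasDerivAt (fun x : ℝ ↦ 3 * (x - 1) ^ 2) (6 * (x - 1)) x := by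
    refine ((((hasDerivAt_id x).sub_const 1).pow 2).const_mul 3).congr_deriv ?_
    simp
    ring
  refine ((h1.mul (hasDerivAt_klFun hx)).sub h2).congr_deriv ?_
  rw [klFun_apply]
  ring

lemma two_mul_sub_one_le_add_one_mul_log {x : ℝ} (hx : 1 ≤ x) :
    2 * (x - 1) ≤ (x + 1) * Real.log x := by
  have h := Real.le_log_one_add_of_nonneg (sub_nonneg.2 hx)
  rw [div_le_iff₀ (by linarith)] at h
  rw [add_sub_cancel] at h
  linarith

lemma add_one_mul_log_le_two_mul_sub_one {x : ℝ} (hx0 : 0 < x) (hx : x ≤ 1) :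
    (x + 1) * Real.log x ≤ 2 * (x - 1) := by
  have h := two_mul_sub_one_le_add_one_mul_log ((one_le_inv₀ hx0).2 hx)
  rw [Real.log_inv] at h
  have h' := mul_le_mul_of_nonneg_left h hx0.le
  have hinv : x * x⁻¹ = 1 := mul_inv_cancel₀ hx0.ne'
  linear_combination h' - (2 + Real.log x) * hinv

/-- A quadratic lower bound for `klFun` with the sharp second-order behaviour at `1`. -/
lemma three_mul_sub_one_sq_le_mul_klFun {x : ℝ} (hx : 0 ≤ x) :
    3 * (x - 1) ^ 2 ≤ (2 * x + 4) * klFun x := by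
  have hcont : Continuous fun x : ℝ ↦ (2 * x + 4) * klFun x - 3 * (x - 1) ^ 2 := by
    have := continuous_klFun
    fun_prop
  suffices h : (2 * 1 + 4) * klFun 1 - 3 * ((1 : ℝ) - 1) ^ 2 ≤
      (2 * x + 4) * klFun x - 3 * (x - 1) ^ 2 by
    rw [klFun_one] at h
    linarith
  rcases le_total x 1 with hx1 | hx1
  · have hanti : AntitoneOn (fun x : ℝ ↦ (2 * x + 4) * klFun x - 3 * (x - 1) ^ 2)
        (Set.Icc 0 1) := by
      refine antitoneOn_of_hasDerivWithinAt_nonpos (convex_Icc 0 1) hcont.continuousOn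
        (f' := fun x ↦ 4 * ((x + 1) * Real.log x - 2 * (x - 1))) (fun z hz ↦ ?_) fun z hz ↦ ?_
      all_goals rw [interior_Icc] at hz
      · exact (hasDerivAt_mul_klFun_sub_sq hz.1.ne').hasDerivWithinAt
      · linarith [add_one_mul_log_le_two_mul_sub_one hz.1 hz.2.le]
    exact hanti ⟨hx, hx1⟩ ⟨zero_le_one, le_rfl⟩ hx1
  · have hmono : MonotoneOn (fun x : ℝ ↦ (2 * x + 4) * klFun x - 3 * (x - 1) ^ 2)
        (Set.Ici 1) := by
      refine monotoneOn_of_hasDerivWithinAt_nonneg (convex_Ici 1) hcont.continuousOn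
        (f' := fun x ↦ 4 * ((x + 1) * Real.log x - 2 * (x - 1))) (fun z hz ↦ ?_) fun z hz ↦ ?_
      all_goals rw [interior_Ici, Set.mem_Ioi] at hz
      · exact (hasDerivAt_mul_klFun_sub_sq (by linarith)).hasDerivWithinAt
      · linarith [two_mul_sub_one_le_add_one_mul_log hz.le]
    exact hmono Set.self_mem_Ici hx1 hx1

lemma sub_sq_div_le_mul_log_div {a b : ℝ} (ha : 0 ≤ a) (hb : 0 < b) :
    (a - b) ^ 2 / ((2 * a + 4 * b) / 3) ≤ a * Real.log (a / b) - a + b := by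
  have h := mul_le_mul_of_nonneg_left
    (three_mul_sub_one_sq_le_mul_klFun (div_nonneg ha hb.le)) (sq_nonneg b)
  have hl : b ^ 2 * (3 * (a / b - 1) ^ 2) = 3 * (a - b) ^ 2 := by
    field_simp
  have hr : b ^ 2 * ((2 * (a / b) + 4) * klFun (a / b)) =
      (2 * a + 4 * b) * (a * Real.log (a / b) - a + b) := by
    rw [klFun_apply]
    field_simp
    ring
  rw [hl, hr] at h
  rw [div_le_iff₀ (by positivity)]
  linarith

/-- The Kullback–Leibler (Bregman) divergence of the negative entropy,
`D_F(y, y') = ∑ i, (y i * log (y i / y' i) - y i + y' i)`, satisfies the strong-convexity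
lower bound `D_F(y, y') ≥ ‖y - y'‖₁² / (2m)` on the `ℓ¹`-ball of radius `m`. -/
theorem KL_strong_convexity
    (d : ℕ) (hd : 1 ≤ d) (m : ℝ) (hm : 0 < m)
    (y y' : Fin d → ℝ) (hy : ∀ i, 0 ≤ y i) (hy' : ∀ i, 0 < y' i)
    (hym : (∑ i, |y i|) ≤ m) (hy'm : (∑ i, |y' i|) ≤ m) :
    (1 / (2 * m)) * (∑ i, |y i - y' i|) ^ 2 ≤
      ∑ i, (y i * Real.log (y i / y' i) - y i + y' i) := by
  have hy_sum : ∑ i, y i ≤ m := (Finset.sum_le_sum fun i _ ↦ le_abs_self (y i)).trans hym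
  have hy'_sum : ∑ i, y' i ≤ m := (Finset.sum_le_sum fun i _ ↦ le_abs_self (y' i)).trans hy'm
  have hw : ∀ i, 0 < (2 * y i + 4 * y' i) / 3 := fun i ↦ by
    linarith [hy i, hy' i]
  have hw_sum : ∑ i, (2 * y i + 4 * y' i) / 3 ≤ 2 * m := by
    rw [← Finset.sum_div, Finset.sum_add_distrib, ← Finset.mul_sum, ← Finset.mul_sum]
    linarith
  have hw_pos : 0 < ∑ i, (2 * y i + 4 * y' i) / 3 :=
    Finset.sum_pos (fun i _ ↦ hw i) ⟨⟨0, hd⟩, Finset.mem_univ _⟩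
  calc (1 / (2 * m)) * (∑ i, |y i - y' i|) ^ 2
      = (∑ i, |y i - y' i|) ^ 2 / (2 * m) := by ring
    _ ≤ (∑ i, |y i - y' i|) ^ 2 / ∑ i, (2 * y i + 4 * y' i) / 3 := by gcongr
    _ ≤ ∑ i, |y i - y' i| ^ 2 / ((2 * y i + 4 * y' i) / 3) :=
        Finset.sq_sum_div_le_sum_sq_div _ _ fun i _ ↦ hw i
    _ ≤ ∑ i, (y i * Real.log (y i / y' i) - y i + y' i) := by
        refine Finset.sum_le_sum fun i _ ↦ ?_
        rw [sq_abs]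
        exact sub_sq_div_le_mul_log_div (hy i) (hy' i)
end

section
/- Fix m > 0, y ∈ (0,∞)^d with ‖y‖₁ ≤ m, and v ∈ ℝ^d. The function w ↦ ⟨v, w − y⟩ + D_F(w, y) on {w ∈ (0,∞)^d : ‖w‖₁ ≤ m} has a unique minimizer, given componentwise by w_i = y_i e^{−v_i} if ‖y e^{−v}‖₁ ≤ m, and by w_i = (m/‖y e^{−v}‖₁) y_i e^{−v_i} otherwise, where y e^{−v} := (y_1 e^{−v_1}, …, y_d e^{−v_d}). -/
open scoped BigOperators Classical

noncomputable section

/-- Bregman divergence of the negative entropy (Kullback–Leibler divergence):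
`D_F(w, y) = ∑ i, (w i * log (w i / y i) - w i + y i)`, with the convention `0 log 0 = 0`. -/
def DF (d : ℕ) (w y : Fin d → ℝ) : ℝ :=
  ∑ i, (w i * Real.log (w i / y i) - w i + y i)

/-- The entropic proximal mapping `P^m_y(v)`: it equals `y e^{-v}` componentwise if
`‖y e^{-v}‖₁ ≤ m`, and `(m/‖y e^{-v}‖₁) y e^{-v}` otherwise. -/
def proxMap (d : ℕ) (m : ℝ) (y v : Fin d → ℝ) : Fin d → ℝ :=
  if (∑ i, y i * Real.exp (-v i)) ≤ m then fun i => y i * Real.exp (-v i)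
  else fun i => (m / ∑ j, y j * Real.exp (-v j)) * (y i * Real.exp (-v i))

/-- The summand of the Kullback–Leibler divergence is positive off the diagonal. -/
theorem mul_log_div_sub_add_pos {a b : ℝ} (ha : 0 < a) (hb : 0 < b) (hab : a ≠ b) :
    0 < a * Real.log (a / b) - a + b := by
  have hne : b / a ≠ 1 := fun h => hab ((div_eq_one_iff_eq ha.ne').1 h).symm
  have hlog := mul_lt_mul_of_pos_left (Real.log_lt_sub_one_of_pos (div_pos hb ha) hne) ha
  rw [← inv_div b a, Real.log_inv]
  have hmul : a * (b / a - 1) = b - a := by field_simp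
  linarith

theorem DF_pos {d : ℕ} {w p : Fin d → ℝ} (hw : ∀ i, 0 < w i) (hp : ∀ i, 0 < p i)
    (hne : w ≠ p) : 0 < DF d w p := by
  obtain ⟨j, hj⟩ := Function.ne_iff.1 hne
  refine Finset.sum_pos' (fun i _ => ?_)
    ⟨j, Finset.mem_univ j, mul_log_div_sub_add_pos (hw j) (hp j) hj⟩
  by_cases h : w i = p i
  · simp [h, (hp i).ne']
  · exact (mul_log_div_sub_add_pos (hw i) (hp i) h).le

/-- Three-point identity for the proximal objective at a rescaling of `y e^{-v}`. -/
theorem inner_add_DF_eq {d : ℕ} {c : ℝ} (hc : 0 < c) {y v w p : Fin d → ℝ}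
    (hy : ∀ i, 0 < y i) (hw : ∀ i, 0 < w i) (hp : ∀ i, p i = c * (y i * Real.exp (-v i))) :
    (∑ i, v i * (w i - y i)) + DF d w y =
      (∑ i, v i * (p i - y i)) + DF d p y +
        (DF d w p + Real.log c * (∑ i, w i - ∑ i, p i)) := by
  simp only [DF, ← Finset.sum_sub_distrib, Finset.mul_sum, ← Finset.sum_add_distrib]
  refine Finset.sum_congr rfl fun i _ => ?_
  have hye : 0 < y i * Real.exp (-v i) := mul_pos (hy i) (Real.exp_pos _)
  have hpi : 0 < p i := hp i ▸ mul_pos hc hye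
  have hlog : Real.log (p i) = Real.log c + (Real.log (y i) - v i) := by
    rw [hp i, Real.log_mul hc.ne' hye.ne', Real.log_mul (hy i).ne' (Real.exp_pos _).ne',
      Real.log_exp, sub_eq_add_neg]
  rw [Real.log_div (hw i).ne' (hy i).ne', Real.log_div hpi.ne' (hy i).ne',
    Real.log_div (hw i).ne' hpi.ne', hlog]
  ring

/-- The proximal mapping rescales `y e^{-v}` by a factor at most `1`, and the mass constraint is
active when the factor differs from `1`. -/
theorem exists_proxMap_eq_mul {d : ℕ} {m : ℝ} (hm : 0 < m) (y v : Fin d → ℝ) :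
    ∃ c : ℝ, 0 < c ∧ c ≤ 1 ∧ (∀ i, proxMap d m y v i = c * (y i * Real.exp (-v i))) ∧
      ∑ i, proxMap d m y v i ≤ m ∧ (c = 1 ∨ ∑ i, proxMap d m y v i = m) := by
  by_cases h : ∑ i, y i * Real.exp (-v i) ≤ m
  · exact ⟨1, one_pos, le_rfl, by simp [proxMap, h], by simp [proxMap, h], Or.inl rfl⟩
  · have hlt := not_le.1 h
    have hS := hm.trans hlt
    have hsum : ∑ i, proxMap d m y v i = m := by
      simp only [proxMap, if_neg h, ← Finset.mul_sum]
      exact div_mul_cancel₀ m hS.ne'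
    exact ⟨m / ∑ j, y j * Real.exp (-v j), div_pos hm hS, (div_le_one hS).2 hlt.le,
      fun i => by simp only [proxMap, if_neg h], hsum.le, Or.inr hsum⟩

/-- For `y ∈ (0,∞)^d` with `‖y‖₁ ≤ m` and `v ∈ ℝ^d`, the map
`w ↦ ⟨v, w - y⟩ + D_F(w, y)` on `{w ∈ (0,∞)^d : ‖w‖₁ ≤ m}` has `P^m_y(v)` as unique
minimizer. -/
theorem proxMap_is_unique_minimizer
    (d : ℕ) (hd : 1 ≤ d) (m : ℝ) (hm : 0 < m)
    (y : Fin d → ℝ) (hy : ∀ i, 0 < y i) (hym : (∑ i, |y i|) ≤ m)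
    (v : Fin d → ℝ) :
    (∀ i, 0 < proxMap d m y v i) ∧ (∑ i, |proxMap d m y v i|) ≤ m ∧
    (∀ w : Fin d → ℝ, (∀ i, 0 < w i) → (∑ i, |w i|) ≤ m → w ≠ proxMap d m y v →
      (∑ i, v i * (proxMap d m y v i - y i)) + DF d (proxMap d m y v) y <
        (∑ i, v i * (w i - y i)) + DF d w y) := by
  obtain ⟨c, hc, hc1, hp, hle, hact⟩ := exists_proxMap_eq_mul hm y v
  have hpos : ∀ i, 0 < proxMap d m y v i := fun i =>
    hp i ▸ mul_pos hc (mul_pos (hy i) (Real.exp_pos _))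
  refine ⟨hpos, by simpa only [abs_of_pos (hpos _)] using hle, fun w hw hwm hne => ?_⟩
  simp only [abs_of_pos (hw _)] at hwm
  rw [inner_add_DF_eq hc hy hw hp]
  have hmul : 0 ≤ Real.log c * (∑ i, w i - ∑ i, proxMap d m y v i) := by
    rcases hact with rfl | h
    · simp
    · exact mul_nonneg_of_nonpos_of_nonpos (Real.log_nonpos hc.le hc1) (by linarith)
  have hDF := DF_pos hw hpos hne
  linarith

end
end

section
/- For any w ∈ ℝ_+^d and u ∈ (0,∞)^d with ‖w‖₁ ≤ m and ‖u‖₁ ≤ m, and any v ∈ ℝ^d, the proximal mapping satisfies D_F(w, P^m_u(v)) ≤ D_F(w, u) + ⟨v, w − u⟩ + (m/2) ‖v‖_∞². -/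
open scoped BigOperators Classical

noncomputable section

open Set in
/-- A Padé-type lower bound for the logarithm, with equality at `t = 1`. -/
lemma pade_le_log {t : ℝ} (ht : 0 < t) :
    5 / 2 - 1 / 4 * t⁻¹ - 27 / 4 * (t + 2)⁻¹ ≤ Real.log t := by
  set f : ℝ → ℝ := fun s => Real.log s - (5 / 2 - 1 / 4 * s⁻¹ - 27 / 4 * (s + 2)⁻¹) with hf
  have hderiv : ∀ s : ℝ, 0 < s → HasDerivAt f ((s - 1) ^ 3 / (s ^ 2 * (s + 2) ^ 2)) s := by
    intro s hs
    have h2 : s + 2 ≠ 0 := by positivity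
    have h := (Real.hasDerivAt_log hs.ne').sub
      ((((hasDerivAt_inv hs.ne').const_mul (1 / 4)).const_sub (5 / 2)).sub
        ((((hasDerivAt_id s).add_const 2).inv h2).const_mul (27 / 4)))
    refine HasDerivAt.congr_deriv (f := f) h ?_
    simp only [id]
    field_simp
    ring
  have hcont : ContinuousOn f (Ioi 0) := fun s hs =>
    (hderiv s hs).continuousAt.continuousWithinAt
  have h1 : f 1 = 0 := by norm_num [hf]
  suffices h : f 1 ≤ f t by rw [h1] at h; simpa [hf] using h
  rcases le_total 1 t with h | h
  · refine monotoneOn_of_deriv_nonneg (convex_Icc 1 t)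
      (hcont.mono fun s hs => lt_of_lt_of_le one_pos hs.1) ?_ ?_
      (left_mem_Icc.2 h) (right_mem_Icc.2 h) h
    · rw [interior_Icc]
      exact fun s hs => (hderiv s (one_pos.trans hs.1)).differentiableAt.differentiableWithinAt
    · rw [interior_Icc]
      intro s hs
      rw [(hderiv s (one_pos.trans hs.1)).deriv]
      have : 0 ≤ s - 1 := by linarith [hs.1]
      positivity
  · refine antitoneOn_of_deriv_nonpos (convex_Icc t 1)
      (hcont.mono fun s hs => lt_of_lt_of_le ht hs.1) ?_ ?_
      (left_mem_Icc.2 h) (right_mem_Icc.2 h) h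
    · rw [interior_Icc]
      exact fun s hs => (hderiv s (ht.trans hs.1)).differentiableAt.differentiableWithinAt
    · rw [interior_Icc]
      intro s hs
      rw [(hderiv s (ht.trans hs.1)).deriv]
      exact div_nonpos_of_nonpos_of_nonneg
        (Odd.pow_nonpos (by decide) (by linarith [hs.2])) (by positivity)

/-- Pointwise quadratic lower bound for the Kullback–Leibler divergence. -/
lemma quadratic_le_kl {a b : ℝ} (ha : 0 < a) (hb : 0 < b) :
    3 * (a - b) ^ 2 / (2 * (a + 2 * b)) ≤ a * Real.log (a / b) - a + b := by
  have h := mul_le_mul_of_nonneg_left (pade_le_log (div_pos ha hb)) ha.le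
  have e : a * (5 / 2 - 1 / 4 * (a / b)⁻¹ - 27 / 4 * (a / b + 2)⁻¹) - a + b =
      3 * (a - b) ^ 2 / (2 * (a + 2 * b)) := by
    have : a / b + 2 = (a + 2 * b) / b := by field_simp
    rw [this]
    field_simp
    ring
  linarith

/-- Pointwise Fenchel–Young type bound dual to `quadratic_le_kl`. -/
lemma mul_sub_sub_kl_le {a b c : ℝ} (ha : 0 < a) (hb : 0 < b) :
    c * (b - a) - (a * Real.log (a / b) - a + b) ≤ c ^ 2 / 6 * (a + 2 * b) := by
  have h := quadratic_le_kl ha hb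
  have hs : 0 < a + 2 * b := by positivity
  have e : c ^ 2 / 6 * (a + 2 * b) - c * (b - a) + 3 * (a - b) ^ 2 / (2 * (a + 2 * b)) =
      (c * (a + 2 * b) - 3 * (b - a)) ^ 2 / (6 * (a + 2 * b)) := by
    field_simp
    ring
  have : 0 ≤ (c * (a + 2 * b) - 3 * (b - a)) ^ 2 / (6 * (a + 2 * b)) := by positivity
  linarith

/-- The negative entropy is strongly convex on the `ℓ¹`-ball of radius `m`, in dual form. -/
lemma sum_mul_sub_sub_DF_le {d : ℕ} {m : ℝ} {z u : Fin d → ℝ} (hz : ∀ i, 0 < z i)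
    (hu : ∀ i, 0 < u i) (hzm : ∑ i, z i ≤ m) (hum : ∑ i, u i ≤ m) (v : Fin d → ℝ) :
    ∑ i, v i * (u i - z i) - DF d z u ≤ (m / 2) * (⨆ i, |v i|) ^ 2 := by
  set V := ⨆ i, |v i|
  have hV : ∀ i, v i ^ 2 ≤ V ^ 2 := fun i =>
    sq_le_sq' (abs_le.1 (le_ciSup (f := fun i => |v i|) (Set.finite_range _).bddAbove i)).1
      (abs_le.1 (le_ciSup (f := fun i => |v i|) (Set.finite_range _).bddAbove i)).2
  calc ∑ i, v i * (u i - z i) - DF d z u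
      = ∑ i, (v i * (u i - z i) - (z i * Real.log (z i / u i) - z i + u i)) := by
        rw [DF, Finset.sum_sub_distrib]
    _ ≤ ∑ i, V ^ 2 / 6 * (z i + 2 * u i) := by
        refine Finset.sum_le_sum fun i _ => (mul_sub_sub_kl_le (hz i) (hu i)).trans ?_
        have := hz i
        have := hu i
        gcongr ?_ / 6 * _
        exact hV i
    _ = V ^ 2 / 6 * (∑ i, z i + 2 * ∑ i, u i) := by
        rw [← Finset.mul_sum, Finset.sum_add_distrib, Finset.mul_sum]
    _ ≤ V ^ 2 / 6 * (m + 2 * m) := by gcongr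
    _ = (m / 2) * V ^ 2 := by ring

/-- Three-point identity for the exponential update `z = u e^{-(v + L)}`. -/
lemma DF_exp_update {d : ℕ} (w : Fin d → ℝ) (hw : ∀ i, 0 ≤ w i) {u : Fin d → ℝ}
    (hu : ∀ i, 0 < u i) (v : Fin d → ℝ) (L : ℝ) {z : Fin d → ℝ}
    (hz : ∀ i, z i = Real.exp (-L) * (u i * Real.exp (-v i))) :
    DF d w z = DF d w u + ∑ i, v i * (w i - u i) + (∑ i, v i * (u i - z i) - DF d z u) +
      L * (∑ i, w i - ∑ i, z i) := by
  simp only [DF, mul_sub L, Finset.mul_sum, ← Finset.sum_add_distrib, ← Finset.sum_sub_distrib]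
  refine Finset.sum_congr rfl fun i _ => ?_
  have hui := hu i
  have hzu : z i / u i = Real.exp (-L - v i) := by
    rw [hz, sub_eq_add_neg, Real.exp_add]
    field_simp
  have hzi : z i = u i * Real.exp (-L - v i) := by rw [← hzu]; field_simp
  rw [hzu, Real.log_exp]
  rcases (hw i).eq_or_lt with h0 | h0
  · rw [← h0]
    ring
  · have hlog : Real.log (w i / z i) = Real.log (w i / u i) + L + v i := by
      rw [hzi, ← div_div, Real.log_div (div_pos h0 hui).ne' (Real.exp_pos _).ne', Real.log_exp]
      ring
    rw [hlog]
    ring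

/-- key proximal inequality, Lemma 2.1 of Nemirovski et al. adapted.
For `w` nonnegative and `u` positive, both in the `ℓ¹`-ball of radius `m`, and any `v`,
`D_F(w, P^m_u(v)) ≤ D_F(w, u) + ⟨v, w - u⟩ + (m/2) ‖v‖_∞²`. -/
theorem proxMap_key_inequality
    (d : ℕ) (hd : 1 ≤ d) (m : ℝ) (hm : 0 < m)
    (w : Fin d → ℝ) (hw : ∀ i, 0 ≤ w i) (hwm : (∑ i, |w i|) ≤ m)
    (u : Fin d → ℝ) (hu : ∀ i, 0 < u i) (hum : (∑ i, |u i|) ≤ m)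
    (v : Fin d → ℝ) :
    DF d w (proxMap d m u v) ≤
      DF d w u + (∑ i, v i * (w i - u i)) + (m / 2) * (⨆ i, |v i|) ^ 2 := by
  have hwm' : ∑ i, w i ≤ m := by simpa only [abs_of_nonneg (hw _)] using hwm
  have hum' : ∑ i, u i ≤ m := by simpa only [abs_of_pos (hu _)] using hum
  obtain ⟨L, hz, hzm, hL⟩ : ∃ L : ℝ,
      (∀ i, proxMap d m u v i = Real.exp (-L) * (u i * Real.exp (-v i))) ∧
      ∑ i, proxMap d m u v i ≤ m ∧ L * (∑ i, w i - ∑ i, proxMap d m u v i) ≤ 0 := by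
    by_cases h : ∑ i, u i * Real.exp (-v i) ≤ m
    · exact ⟨0, by simp [proxMap, h], by simp [proxMap, h], by simp⟩
    · have hpos := hm.trans (not_le.1 h)
      have hsum : ∑ i, proxMap d m u v i = m := by
        simp only [proxMap, if_neg h]
        rw [← Finset.mul_sum, div_mul_cancel₀ _ hpos.ne']
      refine ⟨Real.log ((∑ i, u i * Real.exp (-v i)) / m), fun i => ?_, hsum.le, ?_⟩
      · rw [← Real.log_inv, inv_div, Real.exp_log (div_pos hm hpos), proxMap, if_neg h]
      · rw [hsum]
        exact mul_nonpos_of_nonneg_of_nonpos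
          (Real.log_nonneg ((one_le_div hm).2 (not_le.1 h).le)) (by linarith)
  have hzpos : ∀ i, 0 < proxMap d m u v i := fun i => by
    have := hu i
    rw [hz]
    positivity
  linarith [DF_exp_update w hw hu v L hz, sum_mul_sub_sub_DF_le hzpos hu hzm hum' v]

end
end

section
/- Assume m ≥ ‖y*‖₁, that S := sup { g'(r(y)) ‖∇r(y)‖_∞ : y ∈ (0,∞)^d, ‖y‖₁ ≤ m } < ∞, and that the positive steps (γ_n)_{n≥1} satisfy Σ_n γ_n = ∞ and Σ_n γ_n² < ∞. Let y⁰ ∈ (0,∞)^d with ‖y⁰‖₁ ≤ m and define recursively y^{k+1} = P^m_{y^k}( γ_{k+1} κ(y^k) ∇Γ_g(y^k) ). Then y^n converges to y* as n → ∞. -/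
open scoped BigOperators Classical
open Set Filter

noncomputable section

/-- The taming factor `κ(y) = min (min_i y_i) 1`. -/
def kappa (d : ℕ) (y : Fin d → ℝ) : ℝ := min (⨅ i, y i) 1

/-- The generalized Kullback–Leibler divergence between two real numbers. -/
def klTerm (x y : ℝ) : ℝ := x * Real.log x - x * Real.log y - x + y

lemma sq_sqrt_sub_sqrt_le_klTerm {x y : ℝ} (hx : 0 < x) (hy : 0 < y) :
    (√x - √y) ^ 2 ≤ klTerm x y := by
  have h := Real.log_le_sub_one_of_pos (div_pos (Real.sqrt_pos.2 hy) (Real.sqrt_pos.2 hx))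
  rw [Real.log_div (Real.sqrt_pos.2 hy).ne' (Real.sqrt_pos.2 hx).ne', Real.log_sqrt hy.le,
    Real.log_sqrt hx.le] at h
  have h' := mul_le_mul_of_nonneg_left h hx.le
  have e : x * (√y / √x - 1) = √x * √y - x := by
    have := (Real.sqrt_pos.2 hx).ne'
    field_simp
    linear_combination (-√y) * Real.sq_sqrt hx.le
  rw [e] at h'
  unfold klTerm
  nlinarith [Real.sq_sqrt hx.le, Real.sq_sqrt hy.le]

lemma klTerm_nonneg {x y : ℝ} (hx : 0 < x) (hy : 0 < y) : 0 ≤ klTerm x y :=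
  (sq_nonneg _).trans (sq_sqrt_sub_sqrt_le_klTerm hx hy)

lemma le_of_klTerm_le {x y R : ℝ} (hx : 0 < x) (hy : 0 < y) (h : klTerm x y ≤ R) :
    x * Real.exp (-(R / x + 1)) ≤ y := by
  have key : Real.log x - (R / x + 1) ≤ Real.log y := by
    refine le_of_mul_le_mul_left ?_ hx
    have e : x * (Real.log x - (R / x + 1)) = x * Real.log x - R - x := by
      field_simp
      ring
    unfold klTerm at h
    linarith
  calc x * Real.exp (-(R / x + 1)) = Real.exp (Real.log x - (R / x + 1)) := by
        rw [sub_eq_add_neg, Real.exp_add, Real.exp_log hx]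
    _ ≤ Real.exp (Real.log y) := Real.exp_le_exp.2 key
    _ = y := Real.exp_log hy

/-- The generalized Kullback–Leibler divergence between two vectors. -/
def klSum {d : ℕ} (x y : Fin d → ℝ) : ℝ := ∑ i, klTerm (x i) (y i)

lemma klTerm_le_klSum {d : ℕ} {x y : Fin d → ℝ} (hx : ∀ i, 0 < x i) (hy : ∀ i, 0 < y i)
    (i : Fin d) : klTerm (x i) (y i) ≤ klSum x y :=
  Finset.single_le_sum (f := fun i => klTerm (x i) (y i))
    (fun j _ => klTerm_nonneg (hx j) (hy j)) (Finset.mem_univ i)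

lemma klSum_nonneg {d : ℕ} {x y : Fin d → ℝ} (hx : ∀ i, 0 < x i) (hy : ∀ i, 0 < y i) :
    0 ≤ klSum x y :=
  Finset.sum_nonneg fun j _ => klTerm_nonneg (hx j) (hy j)

lemma klSum_self {d : ℕ} (x : Fin d → ℝ) : klSum x x = 0 := by
  simp [klSum, klTerm]

lemma klSum_mul_exp {d : ℕ} (x : Fin d → ℝ) {y : Fin d → ℝ} (v : Fin d → ℝ)
    (hy : ∀ i, 0 < y i) :
    klSum x (fun i => y i * Real.exp (-v i)) =
      klSum x y - ∑ i, v i * (y i - x i) + ∑ i, y i * (Real.exp (-v i) - 1 + v i) := by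
  unfold klSum
  rw [← Finset.sum_sub_distrib, ← Finset.sum_add_distrib]
  refine Finset.sum_congr rfl fun i _ => ?_
  unfold klTerm
  rw [Real.log_mul (hy i).ne' (Real.exp_pos _).ne', Real.log_exp]
  ring

lemma klSum_const_mul_le {d : ℕ} {m : ℝ} {x z : Fin d → ℝ} (hm : 0 < m) (hz : ∀ i, 0 < z i)
    (hxm : ∑ i, x i ≤ m) (hzm : m < ∑ i, z i) :
    klSum x (fun i => (m / ∑ j, z j) * z i) ≤ klSum x z := by
  set s := ∑ j, z j with hs
  have hs0 : 0 < s := hm.trans hzm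
  have e : klSum x (fun i => (m / s) * z i) =
      klSum x z - (∑ i, x i) * Real.log (m / s) + (m / s - 1) * s := by
    unfold klSum
    rw [hs, Finset.mul_sum, Finset.sum_mul, ← Finset.sum_sub_distrib, ← Finset.sum_add_distrib,
      ← hs]
    refine Finset.sum_congr rfl fun i _ => ?_
    unfold klTerm
    rw [Real.log_mul (div_pos hm hs0).ne' (hz i).ne']
    ring
  have h1 : Real.log (s / m) ≤ s / m - 1 := Real.log_le_sub_one_of_pos (div_pos hs0 hm)
  have h0 : 0 ≤ Real.log (s / m) := Real.log_nonneg ((one_le_div hm).2 hzm.le)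
  have h2 : Real.log (m / s) = - Real.log (s / m) := by rw [← Real.log_inv, inv_div]
  have h3 : m * Real.log (s / m) ≤ s - m := by
    have := mul_le_mul_of_nonneg_left h1 hm.le
    rwa [mul_sub, mul_div_cancel₀ _ hm.ne', mul_one] at this
  have h4 : (m / s - 1) * s = m - s := by field_simp
  have h5 := mul_le_mul_of_nonneg_right hxm h0
  rw [e, h2, h4]
  linarith

lemma klSum_proxMap_le {d : ℕ} {m : ℝ} {x y : Fin d → ℝ} (v : Fin d → ℝ) (hm : 0 < m)
    (hy : ∀ i, 0 < y i) (hxm : ∑ i, x i ≤ m) :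
    klSum x (proxMap d m y v) ≤
      klSum x y - ∑ i, v i * (y i - x i) + ∑ i, y i * (Real.exp (-v i) - 1 + v i) := by
  rw [← klSum_mul_exp x v hy]
  unfold proxMap
  split_ifs with h
  · exact le_rfl
  · exact klSum_const_mul_le (z := fun i => y i * Real.exp (-v i)) hm
      (fun i => mul_pos (hy i) (Real.exp_pos _)) hxm (not_le.1 h)

lemma proxMap_pos {d : ℕ} {m : ℝ} {y : Fin d → ℝ} (v : Fin d → ℝ) (hm : 0 < m)
    (hy : ∀ i, 0 < y i) (i : Fin d) : 0 < proxMap d m y v i := by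
  have h := fun i => mul_pos (hy i) (Real.exp_pos (-v i))
  unfold proxMap
  split_ifs with hs
  · exact h i
  · exact mul_pos (div_pos hm (hm.trans (not_le.1 hs))) (h i)

lemma sum_proxMap_le {d : ℕ} {m : ℝ} (y v : Fin d → ℝ) (hm : 0 < m) :
    ∑ i, proxMap d m y v i ≤ m := by
  unfold proxMap
  split_ifs with hs
  · exact hs
  · rw [← Finset.mul_sum, div_mul_cancel₀]
    exact (hm.trans (not_le.1 hs)).ne'

lemma exp_sub_one_sub_id_le (x : ℝ) : Real.exp x - 1 - x ≤ x ^ 2 * Real.exp |x| := by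
  have h1 : 1 ≤ Real.exp |x| := Real.one_le_exp (abs_nonneg x)
  rcases le_total |x| 1 with h | h
  · nlinarith [(abs_le.1 (Real.abs_exp_sub_one_sub_id_le h)).2, sq_nonneg x]
  · have h2 : 1 ≤ x ^ 2 := by nlinarith [sq_abs x]
    rcases le_total 0 x with hx | hx
    · rw [abs_of_nonneg hx] at *
      nlinarith [Real.exp_pos x]
    · have h3 : Real.exp x ≤ 1 := Real.exp_le_one_iff.2 hx
      rw [abs_of_nonpos hx] at *
      nlinarith

/-- A deterministic form of the Robbins–Siegmund almost-supermartingale lemma. -/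
lemma exists_tendsto_and_summable_of_le_sub_add {a u w : ℕ → ℝ} (ha : ∀ n, 0 ≤ a n)
    (hu : ∀ n, 0 ≤ u n) (hw : ∀ n, 0 ≤ w n) (hws : Summable w)
    (h : ∀ n, a (n + 1) ≤ a n - u n + w n) :
    (∃ L, Tendsto a atTop (nhds L)) ∧ Summable u ∧ ∀ n, a n ≤ a 0 + ∑' k, w k := by
  have hsum : ∀ n, a n + ∑ k ∈ Finset.range n, u k ≤ a 0 + ∑ k ∈ Finset.range n, w k := by
    intro n
    induction n with
    | zero => simp
    | succ n ih =>
      rw [Finset.sum_range_succ, Finset.sum_range_succ]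
      linarith [h n]
  have hW : ∀ n, ∑ k ∈ Finset.range n, w k ≤ ∑' k, w k :=
    fun n => hws.sum_le_tsum _ fun k _ => hw k
  have hU : ∀ n, 0 ≤ ∑ k ∈ Finset.range n, u k := fun n => Finset.sum_nonneg fun k _ => hu k
  refine ⟨?_, summable_of_sum_range_le (c := a 0 + ∑' k, w k) hu fun n => ?_, fun n => ?_⟩
  · have hanti : Antitone fun n => a n - ∑ k ∈ Finset.range n, w k := by
      refine antitone_nat_of_succ_le fun n => ?_
      rw [Finset.sum_range_succ]
      linarith [h n, hu n]
    have hbdd : BddBelow (range fun n => a n - ∑ k ∈ Finset.range n, w k) := by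
      refine ⟨-∑' k, w k, ?_⟩
      rintro _ ⟨n, rfl⟩
      have := ha n
      have := hW n
      dsimp only
      linarith
    refine ⟨_, ((tendsto_atTop_ciInf hanti hbdd).add hws.hasSum.tendsto_sum_nat).congr
      fun n => ?_⟩
    ring
  · linarith [hsum n, hW n, ha n]
  · linarith [hsum n, hW n, hU n]

lemma HasDerivAt.le_of_forall_le_add_mul {φ : ℝ → ℝ} {φ' C x : ℝ} (h : HasDerivAt φ φ' x)
    (hC : ∀ t, 0 < t → t ≤ 1 → φ (x + t) ≤ φ x + t * C) : φ' ≤ C := by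
  have hs := h.tendsto_slope_zero_right
  refine le_of_tendsto hs ?_
  filter_upwards [Ioc_mem_nhdsGT (zero_lt_one' ℝ)] with t ht
  rw [smul_eq_mul, inv_mul_le_iff₀ ht.1]
  linarith [hC t ht.1 ht.2]

lemma kappa_pos {d : ℕ} [Nonempty (Fin d)] {y : Fin d → ℝ} (hy : ∀ i, 0 < y i) :
    0 < kappa d y := by
  obtain ⟨i, hi⟩ := exists_eq_ciInf_of_finite (f := y)
  exact lt_min (hi ▸ hy i) one_pos

lemma kappa_mono {d : ℕ} [Nonempty (Fin d)] {y z : Fin d → ℝ} (h : y ≤ z) :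
    kappa d y ≤ kappa d z :=
  min_le_min_right _ (ciInf_mono (Set.finite_range y).bddBelow h)

lemma kappa_le {d : ℕ} (y : Fin d → ℝ) (i : Fin d) : kappa d y ≤ y i :=
  (min_le_left _ _).trans (ciInf_le (Set.finite_range y).bddBelow i)

/-- The first-order inequality for a function that is convex along the segment from `y` to `x`. -/
lemma HasFDerivAt.le_sub_of_segment {E : Type*} [NormedAddCommGroup E] [NormedSpace ℝ E]
    {f : E → ℝ} {f' : E →L[ℝ] ℝ} {x y : E} (h : HasFDerivAt f f' y)
    (hconv : ∀ t : ℝ, 0 < t → t ≤ 1 → f (y + t • (x - y)) ≤ f y + t * (f x - f y)) :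
    f' (x - y) ≤ f x - f y := by
  have hline : HasDerivAt (fun t : ℝ => y + t • (x - y)) (x - y) 0 := by
    simpa using ((hasDerivAt_id (0 : ℝ)).smul_const (x - y)).const_add y
  have hcomp : HasDerivAt (fun t : ℝ => f (y + t • (x - y))) (f' (x - y)) 0 := by
    have h0 : HasFDerivAt f f' (y + (0 : ℝ) • (x - y)) := by simpa using h
    exact h0.comp_hasDerivAt (0 : ℝ) hline
  refine hcomp.le_of_forall_le_add_mul fun t ht ht1 => ?_
  simpa using hconv t ht ht1

lemma sum_mul_exp_sub_one_add_le {d : ℕ} {m A : ℝ} {y v : Fin d → ℝ} {V : ℝ}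
    (hy : ∀ i, 0 < y i) (hym : ∑ i, y i ≤ m) (hv : ∀ i, |v i| ≤ V) (hVA : V ≤ A) :
    ∑ i, y i * (Real.exp (-v i) - 1 + v i) ≤ m * (V ^ 2 * Real.exp A) := by
  calc ∑ i, y i * (Real.exp (-v i) - 1 + v i) ≤ ∑ i, y i * (V ^ 2 * Real.exp A) := by
        refine Finset.sum_le_sum fun i _ => mul_le_mul_of_nonneg_left ?_ (hy i).le
        have h1 := exp_sub_one_sub_id_le (-v i)
        rw [abs_neg, neg_sq, ← sq_abs] at h1
        have h2 : |v i| ^ 2 * Real.exp |v i| ≤ V ^ 2 * Real.exp A := by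
          have := hv i
          have := (hv i).trans hVA
          gcongr
        linarith
    _ = (∑ i, y i) * (V ^ 2 * Real.exp A) := by rw [Finset.sum_mul]
    _ ≤ m * (V ^ 2 * Real.exp A) := by gcongr

lemma tendsto_of_tendsto_klSum {d : ℕ} {x : Fin d → ℝ} {y : ℕ → Fin d → ℝ}
    (hx : ∀ i, 0 < x i) (hy : ∀ n i, 0 < y n i)
    (h : Tendsto (fun n => klSum x (y n)) atTop (nhds 0)) : Tendsto y atTop (nhds x) := by
  rw [tendsto_pi_nhds]
  intro i
  have h1 : Tendsto (fun n => (√(x i) - √(y n i)) ^ 2) atTop (nhds 0) :=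
    squeeze_zero (fun n => sq_nonneg _) (fun n => (sq_sqrt_sub_sqrt_le_klTerm (hx i) (hy n i)).trans
      (klTerm_le_klSum hx (hy n) i)) h
  have h2 : Tendsto (fun n => √(x i) - √(y n i)) atTop (nhds 0) := by
    have := h1.sqrt
    simp only [Real.sqrt_sq_eq_abs, Real.sqrt_zero] at this
    exact (tendsto_zero_iff_abs_tendsto_zero _).2 this
  have h3 := ((tendsto_const_nhds (x := √(x i))).sub h2).pow 2
  simpa [Real.sq_sqrt (hx i).le, Real.sq_sqrt (hy _ i).le] using h3

lemma continuousOn_klSum {d : ℕ} (x : Fin d → ℝ) :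
    ContinuousOn (klSum x) {y : Fin d → ℝ | ∀ i, 0 < y i} := by
  unfold klSum klTerm
  refine continuousOn_finsetSum _ fun i _ => ?_
  have hlog : ContinuousOn (fun y : Fin d → ℝ => Real.log (y i)) {y | ∀ i, 0 < y i} :=
    (continuous_apply i).continuousOn.log fun y hy => (hy i).ne'
  fun_prop

/-- Iterates that are quasi-Fejér monotone for the Kullback–Leibler divergence to `x`, with a
nonnegative gap `Φ` vanishing on the positive orthant only at `x`, converge to `x`. -/
lemma tendsto_of_klSum_le_sub_add {d : ℕ} [Nonempty (Fin d)] {m : ℝ} {x : Fin d → ℝ}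
    {y : ℕ → Fin d → ℝ} {Φ : (Fin d → ℝ) → ℝ} {γ w : ℕ → ℝ}
    (hx : ∀ i, 0 < x i) (hy : ∀ n i, 0 < y n i) (hym : ∀ n, ∑ i, y n i ≤ m)
    (hΦc : ContinuousOn Φ {y : Fin d → ℝ | ∀ i, 0 < y i})
    (hΦ : ∀ z : Fin d → ℝ, (∀ i, 0 < z i) → 0 ≤ Φ z)
    (hΦx : ∀ z : Fin d → ℝ, (∀ i, 0 < z i) → Φ z = 0 → z = x)
    (hγ : ∀ n, 0 < γ n) (hγs : ¬ Summable γ) (hw : ∀ n, 0 ≤ w n) (hws : Summable w)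
    (h : ∀ n, klSum x (y (n + 1)) ≤ klSum x (y n) - γ n * (kappa d (y n) * Φ (y n)) + w n) :
    Tendsto y atTop (nhds x) := by
  obtain ⟨⟨L, hL⟩, hsum, hbdd⟩ := exists_tendsto_and_summable_of_le_sub_add
    (fun n => klSum_nonneg hx (hy n))
    (fun n => mul_nonneg (hγ n).le (mul_nonneg (kappa_pos (hy n)).le (hΦ _ (hy n)))) hw hws h
  set R := klSum x (y 0) + ∑' k, w k
  set c : Fin d → ℝ := fun i => x i * Real.exp (-(R / x i + 1))
  have hc0 : ∀ i, 0 < c i := fun i => mul_pos (hx i) (Real.exp_pos _)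
  have hcy : ∀ n, c ≤ y n := fun n i =>
    le_of_klTerm_le (hx i) (hy n i) ((klTerm_le_klSum hx (hy n) i).trans (hbdd n))
  have hyM : ∀ n, y n ≤ fun _ => m := fun n i =>
    (Finset.single_le_sum (f := y n) (fun j _ => (hy n j).le) (Finset.mem_univ i)).trans (hym n)
  have hL0 : 0 ≤ L := ge_of_tendsto' hL fun n => klSum_nonneg hx (hy n)
  rcases hL0.eq_or_lt with rfl | hLpos
  · exact tendsto_of_tendsto_klSum hx hy hL
  exfalso
  have hIcc : Icc c (fun _ => m) ⊆ {z : Fin d → ℝ | ∀ i, 0 < z i} :=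
    fun z hz i => (hc0 i).trans_le (hz.1 i)
  set K := Icc c (fun _ => m) ∩ klSum x ⁻¹' Ici (L / 2)
  have hKc : IsCompact K := isCompact_Icc.of_isClosed_subset
    (((continuousOn_klSum x).mono hIcc).preimage_isClosed_of_isClosed isClosed_Icc isClosed_Ici)
    inter_subset_left
  have hev : ∀ᶠ n in atTop, y n ∈ K := by
    filter_upwards [hL.eventually (lt_mem_nhds (half_lt_self hLpos))] with n hn
    exact ⟨⟨hcy n, hyM n⟩, le_of_lt hn⟩
  obtain ⟨N, hN⟩ := hev.exists
  obtain ⟨z, hzK, hzmin⟩ := hKc.exists_isMinOn ⟨_, hN⟩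
    (hΦc.mono (inter_subset_left.trans hIcc))
  have hz := hIcc hzK.1
  have hΦz : 0 < Φ z := by
    refine (hΦ z hz).lt_of_ne' fun h0 => ?_
    have h1 : L / 2 ≤ klSum x z := hzK.2
    rw [hΦx z hz h0, klSum_self] at h1
    linarith
  have hε : 0 < kappa d c * Φ z := mul_pos (kappa_pos hc0) hΦz
  refine hγs ((summable_mul_right_iff hε.ne').1 ?_)
  refine hsum.of_norm_bounded_eventually_nat ?_
  filter_upwards [hev] with n hn
  rw [Real.norm_of_nonneg (mul_pos (hγ n) hε).le]
  exact mul_le_mul_of_nonneg_left (mul_le_mul (kappa_mono (hcy n)) (hzmin hn) hΦz.le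
    (kappa_pos (hy n)).le) (hγ n).le

/-- convergence of the deterministic mirror descent scheme.
With `m ≥ ‖y*‖₁`, bounded `S`, steps with `∑ γ_n = ∞` and `∑ γ_n² < ∞`, the DMD iterates
`y^{k+1} = P^m_{y^k}(γ_{k+1} κ(y^k) ∇Γ_g(y^k))` converge to the minimizer `y*` of `Γ_g`. -/
theorem DMD_converges
    (d : ℕ) (hd : 1 ≤ d)
    (b : Fin d → ℝ) (hb : ∀ i, 0 < b i) (hbsum : ∑ i, b i = 1)
    (r : (Fin d → ℝ) → ℝ) (rGrad : (Fin d → ℝ) → Fin d → ℝ)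
    (g : ℝ → ℝ) (gDeriv : ℝ → ℝ)
    (hr_cont : ContinuousOn r {y : Fin d → ℝ | ∀ i, 0 ≤ y i})
    (hr_diff : ∀ y : Fin d → ℝ, (∀ i, 0 < y i) →
      HasFDerivAt r (∑ i, rGrad y i • (ContinuousLinearMap.proj i : (Fin d → ℝ) →L[ℝ] ℝ)) y)
    (hrGrad_cont : ContinuousOn rGrad {y : Fin d → ℝ | ∀ i, 0 < y i})
    (hr_hom : ∀ c : ℝ, 0 ≤ c → ∀ y : Fin d → ℝ, (∀ i, 0 ≤ y i) → r (c • y) = c * r y)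
    (hr_sub : ∀ y y' : Fin d → ℝ, (∀ i, 0 ≤ y i) → (∀ i, 0 ≤ y' i) →
      r (y + y') ≤ r y + r y')
    (hr_pos : ∀ u : Fin d → ℝ, (∀ i, 0 ≤ u i) → ∑ i, u i = 1 → 0 < r u)
    (hg_diff : ∀ x : ℝ, 0 ≤ x → HasDerivAt g (gDeriv x) x)
    (hgDeriv_cont : ContinuousOn gDeriv (Ici (0 : ℝ)))
    (hg_conv : ConvexOn ℝ (Ici (0 : ℝ)) g)
    (hg_mono : StrictMonoOn g (Ici (0 : ℝ)))
    -- the unique minimizer `y*` of `Γ_g`, with vanishing gradient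
    (ystar : Fin d → ℝ) (hystar_pos : ∀ i, 0 < ystar i)
    (hystar_min : IsMinOn (fun y => g (r y) - ∑ i, b i * Real.log (y i))
      {y : Fin d → ℝ | ∀ i, 0 < y i} ystar)
    (hystar_unique : ∀ y : Fin d → ℝ, (∀ i, 0 < y i) →
      IsMinOn (fun y => g (r y) - ∑ i, b i * Real.log (y i))
        {y : Fin d → ℝ | ∀ i, 0 < y i} y → y = ystar)
    (hystar_grad : ∀ i, gDeriv (r ystar) * rGrad ystar i - b i / ystar i = 0)
    -- the radius `m ≥ ‖y*‖₁` and the finiteness of `S`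
    (m : ℝ) (hm : (∑ i, |ystar i|) ≤ m)
    (hSbdd : BddAbove {t : ℝ | ∃ y : Fin d → ℝ, (∀ i, 0 < y i) ∧ (∑ i, |y i|) ≤ m ∧
      t = gDeriv (r y) * ⨆ i, |rGrad y i|})
    -- the step sequence
    (γ : ℕ → ℝ) (hγpos : ∀ n, 0 < γ (n + 1))
    (hγdiv : Tendsto (fun N => ∑ k ∈ Finset.range N, γ (k + 1)) atTop atTop)
    (hγsq : Summable fun n => γ (n + 1) ^ 2)
    -- the DMD iterates
    (y0 : Fin d → ℝ) (hy0pos : ∀ i, 0 < y0 i) (hy0m : (∑ i, |y0 i|) ≤ m)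
    (yseq : ℕ → Fin d → ℝ) (hinit : yseq 0 = y0)
    (hrec : ∀ k, yseq (k + 1) = proxMap d m (yseq k)
      (fun i => γ (k + 1) * (kappa d (yseq k) *
        (gDeriv (r (yseq k)) * rGrad (yseq k) i - b i / yseq k i)))) :
    Tendsto yseq atTop (nhds ystar) := by
  have : Nonempty (Fin d) := ⟨⟨0, hd⟩⟩
  have hr0 : ∀ y : Fin d → ℝ, (∀ i, 0 < y i) → 0 < r y := by
    intro y hy
    have hs : 0 < ∑ i, y i := Finset.sum_pos (fun i _ => hy i) Finset.univ_nonempty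
    have h1 := hr_pos ((∑ i, y i)⁻¹ • y) (fun i => mul_nonneg (inv_pos.2 hs).le (hy i).le)
      (by simp only [Pi.smul_apply, smul_eq_mul, ← Finset.mul_sum]; exact inv_mul_cancel₀ hs.ne')
    rw [hr_hom _ (inv_pos.2 hs).le y fun i => (hy i).le] at h1
    exact (mul_pos_iff_of_pos_left (inv_pos.2 hs)).1 h1
  have hg0 : ∀ x, 0 ≤ x → 0 ≤ gDeriv x := by
    intro x hx
    have h1 : HasDerivAt (fun t => -g t) (-gDeriv x) x := (hg_diff x hx).neg
    have := h1.le_of_forall_le_add_mul (C := 0) fun t ht _ => by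
      have := hg_mono.monotoneOn (mem_Ici.2 hx) (mem_Ici.2 (by linarith : 0 ≤ x + t))
        (by linarith)
      linarith
    linarith
  have hgrad_r : ∀ y x : Fin d → ℝ, (∀ i, 0 < y i) → (∀ i, 0 < x i) →
      ∑ i, rGrad y i * (x i - y i) ≤ r x - r y := by
    intro y x hy hx
    have h1 := (hr_diff y hy).le_sub_of_segment (x := x) fun t ht ht1 => by
      have e : y + t • (x - y) = (1 - t) • y + t • x := by
        module
      have hy' := fun i => (hy i).le
      have hx' := fun i => (hx i).le
      have h1t : 0 ≤ 1 - t := by linarith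
      have h2 := hr_sub ((1 - t) • y) (t • x) (fun i => mul_nonneg h1t (hy' i))
        (fun i => mul_nonneg ht.le (hx' i))
      rw [hr_hom _ h1t y hy', hr_hom _ ht.le x hx'] at h2
      rw [e]
      linarith
    simpa using h1
  have hgrad_g : ∀ s t : ℝ, 0 ≤ s → 0 ≤ t → gDeriv s * (t - s) ≤ g t - g s := by
    intro s t hs ht
    have h1 := (hg_diff s hs).hasFDerivAt.le_sub_of_segment (x := t) fun a ha ha1 => by
      have h2 := hg_conv.2 (mem_Ici.2 hs) (mem_Ici.2 ht) (by linarith : 0 ≤ 1 - a) ha.le (by ring)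
      simp only [smul_eq_mul] at h2 ⊢
      have e : s + a * (t - s) = (1 - a) * s + a * t := by ring
      rw [e]
      linarith
    simpa [mul_comm] using h1
  set G : (Fin d → ℝ) → ℝ := fun y => g (r y) - ∑ i, b i * Real.log (y i) with hG
  have hgap : ∀ y : Fin d → ℝ, (∀ i, 0 < y i) →
      G y - G ystar ≤ ∑ i, (gDeriv (r y) * rGrad y i - b i / y i) * (y i - ystar i) := by
    intro y hy
    have h1 := hgrad_g (r y) (r ystar) (hr0 y hy).le (hr0 _ hystar_pos).le
    have h2 := mul_le_mul_of_nonneg_left (hgrad_r y ystar hy hystar_pos) (hg0 _ (hr0 y hy).le)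
    have h3 : ∑ i, b i * (Real.log (ystar i) - Real.log (y i)) ≤
        ∑ i, b i / y i * (ystar i - y i) := by
      refine Finset.sum_le_sum fun i _ => ?_
      have h := Real.log_le_sub_one_of_pos (div_pos (hystar_pos i) (hy i))
      rw [Real.log_div (hystar_pos i).ne' (hy i).ne'] at h
      refine (mul_le_mul_of_nonneg_left h (hb i).le).trans_eq ?_
      have := (hy i).ne'
      field_simp
    have e : ∑ i, (gDeriv (r y) * rGrad y i - b i / y i) * (y i - ystar i) =
        -(gDeriv (r y) * ∑ i, rGrad y i * (ystar i - y i)) +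
          ∑ i, b i / y i * (ystar i - y i) := by
      rw [Finset.mul_sum, ← Finset.sum_neg_distrib, ← Finset.sum_add_distrib]
      exact Finset.sum_congr rfl fun i _ => by ring
    simp only [mul_sub, Finset.sum_sub_distrib] at h3
    rw [e]
    simp only [hG]
    simp only [mul_sub, Finset.sum_sub_distrib] at h1 h2 ⊢
    linarith
  have hG_cont : ContinuousOn G {y : Fin d → ℝ | ∀ i, 0 < y i} := by
    refine ContinuousOn.sub ?_ (continuousOn_finsetSum _ fun i _ => continuousOn_const.mul
      ((continuous_apply i).continuousOn.log fun y hy => (hy i).ne'))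
    exact ContinuousOn.comp (t := Ici 0)
      (fun x hx => (hg_diff x hx).continuousAt.continuousWithinAt)
      (hr_cont.mono fun y hy i => (hy i).le) fun y hy => (hr0 y hy).le
  have hm' : ∑ i, ystar i ≤ m := by
    simpa only [abs_of_pos (hystar_pos _)] using hm
  have hm0 : 0 < m :=
    (Finset.sum_pos (fun i _ => hystar_pos i) Finset.univ_nonempty).trans_le hm'
  have hiter : ∀ n, (∀ i, 0 < yseq n i) ∧ ∑ i, yseq n i ≤ m := by
    intro n
    induction n with
    | zero => exact hinit ▸ ⟨hy0pos, by simpa only [abs_of_pos (hy0pos _)] using hy0m⟩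
    | succ n ih =>
      rw [hrec]
      exact ⟨proxMap_pos _ hm0 ih.1, sum_proxMap_le _ _ hm0⟩
  obtain ⟨B, hB⟩ := hSbdd
  have hBy : ∀ y : Fin d → ℝ, (∀ i, 0 < y i) → ∑ i, y i ≤ m →
      ∀ i, |gDeriv (r y) * rGrad y i| ≤ B := by
    intro y hy hym i
    rw [abs_mul, abs_of_nonneg (hg0 _ (hr0 y hy).le)]
    exact (mul_le_mul_of_nonneg_left (le_ciSup (Set.finite_range fun i => |rGrad y i|).bddAbove i)
      (hg0 _ (hr0 y hy).le)).trans (hB ⟨y, hy, by simpa only [abs_of_pos (hy _)] using hym, rfl⟩)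
  have hstep : ∀ n i, |γ (n + 1) * (kappa d (yseq n) *
      (gDeriv (r (yseq n)) * rGrad (yseq n) i - b i / yseq n i))| ≤ γ (n + 1) * (B + 1) := by
    intro n i
    obtain ⟨hy, hym⟩ := hiter n
    rw [abs_mul, abs_of_pos (hγpos n)]
    refine mul_le_mul_of_nonneg_left ?_ (hγpos n).le
    have hk0 := kappa_pos hy
    have hk1 : kappa d (yseq n) ≤ 1 := min_le_right _ _
    have hki := kappa_le (yseq n) i
    have hbi : b i ≤ 1 := hbsum ▸
      Finset.single_le_sum (f := b) (fun j _ => (hb j).le) (Finset.mem_univ i)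
    have h1 := hBy _ hy hym i
    have hq : 0 < b i / yseq n i := div_pos (hb i) (hy i)
    have h2 : kappa d (yseq n) * (b i / yseq n i) ≤ 1 := by
      calc kappa d (yseq n) * (b i / yseq n i) ≤ yseq n i * (b i / yseq n i) := by gcongr
        _ = b i := mul_div_cancel₀ _ (hy i).ne'
        _ ≤ 1 := hbi
    rw [abs_mul, abs_of_pos hk0]
    have h3 := mul_le_mul_of_nonneg_left
      (abs_sub (gDeriv (r (yseq n)) * rGrad (yseq n) i) (b i / yseq n i)) hk0.le
    rw [abs_of_pos hq] at h3
    have h4 := mul_le_mul hk1 h1 (abs_nonneg _) zero_le_one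
    linarith
  have hB0 : 0 ≤ B + 1 := by
    have := (abs_nonneg _).trans (hBy _ hystar_pos hm' ⟨0, hd⟩)
    linarith
  set T := ∑' n, γ (n + 1) ^ 2
  have hγT : ∀ n, γ (n + 1) ≤ √T := fun n =>
    Real.le_sqrt_of_sq_le (hγsq.le_tsum n fun j _ => sq_nonneg _)
  refine tendsto_of_klSum_le_sub_add (m := m) (Φ := fun y => G y - G ystar)
    (γ := fun n => γ (n + 1))
    (w := fun n => m * ((γ (n + 1) * (B + 1)) ^ 2 * Real.exp (√T * (B + 1))))
    hystar_pos (fun n => (hiter n).1) (fun n => (hiter n).2) (hG_cont.sub continuousOn_const)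
    (fun z hz => sub_nonneg.2 (hystar_min hz)) (fun z hz h0 => ?_) hγpos ?_
    (fun n => by positivity) ?_ fun n => ?_
  · exact hystar_unique z hz fun u hu => (sub_eq_zero.1 h0).le.trans (hystar_min hu)
  · exact (not_summable_iff_tendsto_nat_atTop_of_nonneg fun n => (hγpos n).le).2 hγdiv
  · simp only [mul_pow]
    exact ((hγsq.mul_right _).mul_right _).mul_left _
  · obtain ⟨hy, hym⟩ := hiter n
    have h1 := klSum_proxMap_le (x := ystar) (fun i => γ (n + 1) * (kappa d (yseq n) *
        (gDeriv (r (yseq n)) * rGrad (yseq n) i - b i / yseq n i))) hm0 hy hm'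
    rw [← hrec n] at h1
    have h2 := sum_mul_exp_sub_one_add_le hy hym (hstep n)
      (mul_le_mul_of_nonneg_right (hγT n) hB0)
    have h3 : γ (n + 1) * (kappa d (yseq n) * (G (yseq n) - G ystar)) ≤
        ∑ i, γ (n + 1) * (kappa d (yseq n) * (gDeriv (r (yseq n)) * rGrad (yseq n) i -
          b i / yseq n i)) * (yseq n i - ystar i) := by
      simp only [mul_assoc, ← Finset.mul_sum]
      exact mul_le_mul_of_nonneg_left (mul_le_mul_of_nonneg_left (hgap _ hy) (kappa_pos hy).le)
        (hγpos n).le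
    linarith

end
end

section
/- Under assumptions (i)–(ii), and assuming that for every y ∈ (0,∞)^d the function ξ ↦ E[L(ξ, −⟨y,X⟩)] attains its minimum at a unique point ξ*(y), the value function φ(y) := min_{ξ∈ℝ} E[L(ξ, −⟨y, X⟩)] is continuously differentiable on (0,∞)^d with gradient ∇φ(y) = E[ −X ∂_x L(ξ*(y), −⟨y, X⟩) ]. -/
open scoped BigOperators Classical
open Set MeasureTheory

noncomputable section

/-- Tangent plane inequality for a convex function of two real variables, from its partial
derivatives at a single point. -/
theorem ConvexOn.add_partialDeriv_le {L : ℝ → ℝ → ℝ}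
    (hL : ConvexOn ℝ univ (fun p : ℝ × ℝ => L p.1 p.2)) {ξ x A B : ℝ}
    (hA : HasDerivAt (fun t => L t x) A ξ) (hB : HasDerivAt (fun t => L ξ t) B x) (ξ' x' : ℝ) :
    L ξ x + A * (ξ' - ξ) + B * (x' - x) ≤ L ξ' x' := by
  set a := ξ' - ξ with ha
  set b := x' - x with hb
  let χ : ℝ → ℝ := fun t => (1 / 2) * L (ξ + t * (-2 * a)) x + (1 / 2) * L ξ (x + t * (-2 * b))
    + t * (L ξ' x' - L ξ x)
  have hχ : HasDerivAt χ (-(A * a + B * b) + (L ξ' x' - L ξ x)) 0 := by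
    have h1 : HasDerivAt (fun t : ℝ => ξ + t * (-2 * a)) (-2 * a) 0 := by
      simpa using ((hasDerivAt_id (0 : ℝ)).mul_const (-2 * a)).const_add ξ
    have h2 : HasDerivAt (fun t : ℝ => x + t * (-2 * b)) (-2 * b) 0 := by
      simpa using ((hasDerivAt_id (0 : ℝ)).mul_const (-2 * b)).const_add x
    have h3 : HasDerivAt (fun t : ℝ => L (ξ + t * (-2 * a)) x) (A * (-2 * a)) 0 :=
      HasDerivAt.comp (h₂ := fun t => L t x) 0 (by simpa using hA) h1
    have h4 : HasDerivAt (fun t : ℝ => L ξ (x + t * (-2 * b))) (B * (-2 * b)) 0 :=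
      HasDerivAt.comp (h₂ := fun t => L ξ t) 0 (by simpa using hB) h2
    have h5 := ((h3.const_mul (1 / 2)).add (h4.const_mul (1 / 2))).add
      ((hasDerivAt_id (0 : ℝ)).mul_const (L ξ' x' - L ξ x))
    exact h5.congr_deriv (by ring)
  have hχ0 : χ 0 = L ξ x := by simp only [χ, zero_mul, add_zero]; ring
  have hge : ∀ t : ℝ, 0 < t → L ξ x ≤ χ t := by
    intro t ht
    have hmid := hL.2 (mem_univ (ξ + t * (-2 * a), x)) (mem_univ (ξ, x + t * (-2 * b)))
      (by norm_num : (0 : ℝ) ≤ 1 / 2) (by norm_num : (0 : ℝ) ≤ 1 / 2) (by norm_num)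
    have hseg := hL.2 (mem_univ (ξ', x')) (mem_univ (ξ - t * a, x - t * b))
      (by positivity : 0 ≤ t / (1 + t)) (by positivity : 0 ≤ 1 / (1 + t)) (by field_simp; ring)
    simp only [Prod.smul_mk, Prod.mk_add_mk, smul_eq_mul] at hmid hseg
    rw [show (1 / 2 : ℝ) * (ξ + t * (-2 * a)) + 1 / 2 * ξ = ξ - t * a by ring,
      show (1 / 2 : ℝ) * x + 1 / 2 * (x + t * (-2 * b)) = x - t * b by ring] at hmid
    rw [show t / (1 + t) * ξ' + 1 / (1 + t) * (ξ - t * a) = ξ by rw [ha]; field_simp; ring,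
      show t / (1 + t) * x' + 1 / (1 + t) * (x - t * b) = x by rw [hb]; field_simp; ring,
      ← sub_nonneg] at hseg
    have hseg' := mul_nonneg (by positivity : 0 ≤ 1 + t) hseg
    have hexp : (1 + t) * (t / (1 + t) * L ξ' x' + 1 / (1 + t) * L (ξ - t * a) (x - t * b)
        - L ξ x) = t * L ξ' x' + L (ξ - t * a) (x - t * b) - (1 + t) * L ξ x := by
      field_simp
    rw [hexp] at hseg'
    simp only [χ]
    linarith
  have hlim := (hasDerivWithinAt_iff_tendsto_slope' (s := Ioi (0 : ℝ)) (by simp)).1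
    hχ.hasDerivWithinAt
  have hnonneg := ge_of_tendsto hlim (b := 0) (by
    filter_upwards [self_mem_nhdsWithin] with t ht
    rw [slope_def_field, hχ0, sub_zero]
    exact div_nonneg (sub_nonneg.2 (hge t ht)) (le_of_lt ht))
  linarith

/-- A continuous selection of subgradients is a derivative. -/
theorem hasFDerivAt_of_subgradient {E : Type*} [NormedAddCommGroup E] [NormedSpace ℝ E]
    {U : Set E} {φ : E → ℝ} {g : E → E →L[ℝ] ℝ} {y : E} (hU : U ∈ nhds y)
    (hsub : ∀ u ∈ U, ∀ v ∈ U, φ u + g u (v - u) ≤ φ v) (hg : ContinuousAt g y) :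
    HasFDerivAt φ (g y) y := by
  rw [hasFDerivAt_iff_isLittleO, Asymptotics.isLittleO_iff]
  intro c hc
  filter_upwards [hU, Metric.continuousAt_iff'.1 hg c hc] with v hv hgv
  have hyU := mem_of_mem_nhds hU
  have h1 := hsub y hyU v hv
  have h2 := hsub v hv y hyU
  have h3 : g v (y - v) = -(g v (v - y)) := by rw [← map_neg, neg_sub]
  have h4 : (g v - g y) (v - y) ≤ c * ‖v - y‖ :=
    (le_abs_self _).trans (((g v - g y).le_opNorm _).trans
      (mul_le_mul_of_nonneg_right (by rw [← dist_eq_norm]; exact hgv.le) (norm_nonneg _)))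
  rw [_root_.sub_apply] at h4
  rw [Real.norm_eq_abs, abs_le]
  constructor <;> linarith [mul_nonneg hc.le (norm_nonneg (v - y))]

/-- If `(H, g)` is a selection of subgradients of `F` and `F` is continuous in its second argument,
then a unique minimizer in the first argument depends continuously on the second one. -/
theorem continuousAt_argmin_of_subgradient {E : Type*} [TopologicalSpace E]
    {U : Set E} {F H : ℝ → E → ℝ} {ξstar : E → ℝ} {y : E} (hU : U ∈ nhds y)
    (hsub : ∀ u ∈ U, ∀ ξ ξ', F ξ u + H ξ u * (ξ' - ξ) ≤ F ξ' u)
    (hF : ∀ ξ, ContinuousAt (F ξ) y)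
    (hmin : ∀ u ∈ U, ∀ ξ, F (ξstar u) u ≤ F ξ u)
    (huniq : ∀ ξ', (∀ ξ, F ξ' y ≤ F ξ y) → ξ' = ξstar y) :
    ContinuousAt ξstar y := by
  have hlt : ∀ ξ, ξ ≠ ξstar y → F (ξstar y) y < F ξ y := by
    intro ξ hξ
    by_contra! h
    exact hξ (huniq ξ fun ξ' => h.trans (hmin y (mem_of_mem_nhds hU) ξ'))
  rw [Metric.continuousAt_iff']
  intro ε hε
  filter_upwards [hU, (hF (ξstar y)).eventually_lt (hF (ξstar y + ε)) (hlt _ (by linarith)),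
    (hF (ξstar y)).eventually_lt (hF (ξstar y - ε)) (hlt _ (by linarith))] with u hu h1 h2
  have hm := hmin u hu (ξstar y)
  rw [Real.dist_eq, abs_lt]
  constructor
  · by_contra! h
    have h3 := hsub u hu (ξstar y - ε) (ξstar y)
    have h4 := hsub u hu (ξstar y - ε) (ξstar u)
    have h5 : H (ξstar y - ε) u < 0 := by
      by_contra! h0
      nlinarith
    nlinarith
  · by_contra! h
    have h3 := hsub u hu (ξstar y + ε) (ξstar y)
    have h4 := hsub u hu (ξstar y + ε) (ξstar u)
    have h5 : 0 < H (ξstar y + ε) u := by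
      by_contra! h0
      nlinarith
    nlinarith

/-- envelope theorem for the Bayes representation. Under conditions (i)–(ii),
if for every `y ∈ (0,∞)^d` the map `ξ ↦ E[L(ξ, -⟨y,X⟩)]` attains its minimum at the unique
point `ξ*(y)`, then the value function `φ(y) = min_ξ E[L(ξ, -⟨y,X⟩)] = E[L(ξ*(y), -⟨y,X⟩)]`
is continuously differentiable on `(0,∞)^d` with gradient `E[-X ∂_x L(ξ*(y), -⟨y,X⟩)]`. -/
theorem value_function_is_C1
    {Ω : Type*} [MeasurableSpace Ω] (μ : Measure Ω) [IsProbabilityMeasure μ]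
    (d : ℕ) (hd : 1 ≤ d)
    (X : Ω → Fin d → ℝ) (hX : Measurable X)
    (L Lξ Lx : ℝ → ℝ → ℝ)
    (hLconv : ConvexOn ℝ Set.univ (fun p : ℝ × ℝ => L p.1 p.2))
    (hLint : ∀ (ξ : ℝ) (y : Fin d → ℝ), (∀ i, 0 ≤ y i) →
      Integrable (fun ω => L ξ (-(∑ i, y i * X ω i))) μ)
    -- condition (i): a.s. joint continuous differentiability on `ℝ × (0,∞)^d`
    (hC1 : ∀ᵐ ω ∂μ,
      (∀ (ξ : ℝ) (y : Fin d → ℝ), (∀ i, 0 < y i) →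
        HasDerivAt (fun t => L t (-(∑ i, y i * X ω i))) (Lξ ξ (-(∑ i, y i * X ω i))) ξ ∧
        HasDerivAt (fun x => L ξ x) (Lx ξ (-(∑ i, y i * X ω i))) (-(∑ i, y i * X ω i))) ∧
      ContinuousOn (fun p : ℝ × (Fin d → ℝ) =>
          (Lξ p.1 (-(∑ i, p.2 i * X ω i)), Lx p.1 (-(∑ i, p.2 i * X ω i))))
        (Set.univ ×ˢ {y : Fin d → ℝ | ∀ i, 0 < y i}))
    -- condition (ii): local domination of the gradient on closed balls of the domain
    (hdom : ∀ (z₀ : ℝ × (Fin d → ℝ)) (R : ℝ), 0 < R →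
      Metric.closedBall z₀ R ⊆ Set.univ ×ˢ {y : Fin d → ℝ | ∀ i, 0 < y i} →
      ∃ gbd : Ω → ℝ, Integrable gbd μ ∧ ∀ᵐ ω ∂μ, ∀ z ∈ Metric.closedBall z₀ R,
        |Lξ z.1 (-(∑ i, z.2 i * X ω i))| + ‖X ω‖ * |Lx z.1 (-(∑ i, z.2 i * X ω i))| ≤ gbd ω)
    -- `ξ*(y)` is the unique minimizer of `ξ ↦ E[L(ξ, -⟨y,X⟩)]`
    (ξstar : (Fin d → ℝ) → ℝ)
    (hξstar : ∀ y : Fin d → ℝ, (∀ i, 0 < y i) →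
      (∀ ξ : ℝ, (∫ ω, L (ξstar y) (-(∑ i, y i * X ω i)) ∂μ) ≤
        ∫ ω, L ξ (-(∑ i, y i * X ω i)) ∂μ) ∧
      (∀ ξ' : ℝ, (∀ ξ : ℝ, (∫ ω, L ξ' (-(∑ i, y i * X ω i)) ∂μ) ≤
        ∫ ω, L ξ (-(∑ i, y i * X ω i)) ∂μ) → ξ' = ξstar y)) :
    (∀ y : Fin d → ℝ, (∀ i, 0 < y i) →
      HasFDerivAt (fun y' : Fin d → ℝ => ∫ ω, L (ξstar y') (-(∑ i, y' i * X ω i)) ∂μ)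
        (∑ i, (∫ ω, -(X ω i) * Lx (ξstar y) (-(∑ j, y j * X ω j)) ∂μ) •
          (ContinuousLinearMap.proj i : (Fin d → ℝ) →L[ℝ] ℝ)) y) ∧
    ContinuousOn (fun y : Fin d → ℝ =>
        fun i => ∫ ω, -(X ω i) * Lx (ξstar y) (-(∑ j, y j * X ω j)) ∂μ)
      {y : Fin d → ℝ | ∀ i, 0 < y i} := by
  let U : Set (Fin d → ℝ) := {y | ∀ i, 0 < y i}
  have hUo : IsOpen U := by
    have : U = ⋂ i, {y | 0 < y i} := by ext; simp [U]
    rw [this]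
    exact isOpen_iInter_of_finite fun i => isOpen_lt continuous_const (continuous_apply i)
  let s : (Fin d → ℝ) → Ω → ℝ := fun y ω => -(∑ i, y i * X ω i)
  let F : ℝ → (Fin d → ℝ) → ℝ := fun ξ y => ∫ ω, L ξ (s y ω) ∂μ
  let H : ℝ → (Fin d → ℝ) → ℝ := fun ξ y => ∫ ω, Lξ ξ (s y ω) ∂μ
  let G : ℝ → (Fin d → ℝ) → Fin d → ℝ := fun ξ y i => ∫ ω, -(X ω i) * Lx ξ (s y ω) ∂μ
  let T : (Fin d → ℝ) → ((Fin d → ℝ) →L[ℝ] ℝ) := fun w =>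
    ∑ i, w i • (ContinuousLinearMap.proj i : (Fin d → ℝ) →L[ℝ] ℝ)
  have hTc : Continuous T := by fun_prop
  have hXi : ∀ i, Measurable fun ω => X ω i := fun i => (measurable_pi_apply i).comp hX
  have hs : ∀ y, Measurable (s y) := fun y => by fun_prop
  have hLc : Continuous (fun p : ℝ × ℝ => L p.1 p.2) :=
    continuousOn_univ.1 (hLconv.continuousOn isOpen_univ)
  have hmξ : ∀ ξ, ∀ y ∈ U, AEStronglyMeasurable (fun ω => Lξ ξ (s y ω)) μ := by
    intro ξ y hy
    have h1 : Measurable fun p : ℝ × ℝ => deriv (fun t => L t p.1) p.2 :=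
      measurable_deriv_with_param (f := fun x t => L t x) (hLc.comp continuous_swap)
    have h2 : Measurable fun ω => deriv (fun t => L t (s y ω)) ξ :=
      h1.comp ((hs y).prodMk measurable_const)
    refine h2.aestronglyMeasurable.congr ?_
    filter_upwards [hC1] with ω hω
    exact (hω.1 ξ y hy).1.deriv
  have hmx : ∀ ξ, ∀ y ∈ U, AEStronglyMeasurable (fun ω => Lx ξ (s y ω)) μ := by
    intro ξ y hy
    refine ((measurable_deriv (L ξ)).comp (hs y)).aestronglyMeasurable.congr ?_
    filter_upwards [hC1] with ω hω
    exact (hω.1 ξ y hy).2.deriv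
  have hmG : ∀ ξ, ∀ y ∈ U, ∀ i,
      AEStronglyMeasurable (fun ω => -(X ω i) * Lx ξ (s y ω)) μ := fun ξ y hy i =>
    (hXi i).neg.aestronglyMeasurable.mul (hmx ξ y hy)
  -- local domination of both partial derivatives of the integrand
  have hbd : ∀ z₀ : ℝ × (Fin d → ℝ), z₀.2 ∈ U → ∃ R > 0, ∃ gbd : Ω → ℝ, Integrable gbd μ ∧
      ∀ z ∈ Metric.closedBall z₀ R, z.2 ∈ U ∧ ∀ᵐ ω ∂μ, ‖Lξ z.1 (s z.2 ω)‖ ≤ gbd ω ∧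
        ∀ i, ‖-(X ω i) * Lx z.1 (s z.2 ω)‖ ≤ gbd ω := by
    intro z₀ hz₀
    obtain ⟨R, hR, hsub⟩ := Metric.nhds_basis_closedBall.mem_iff.1
      ((isOpen_univ.prod hUo).mem_nhds (⟨mem_univ _, hz₀⟩ : z₀ ∈ univ ×ˢ U))
    obtain ⟨gbd, hgi, hg⟩ := hdom z₀ R hR hsub
    refine ⟨R, hR, gbd, hgi, fun z hz => ⟨(hsub hz).2, ?_⟩⟩
    filter_upwards [hg] with ω hω
    have h := hω z hz
    have h0 : 0 ≤ ‖X ω‖ * |Lx z.1 (s z.2 ω)| := by positivity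
    refine ⟨by rw [Real.norm_eq_abs]; linarith, fun i => ?_⟩
    rw [norm_mul, norm_neg, Real.norm_eq_abs (Lx _ _)]
    have h1 := mul_le_mul_of_nonneg_right (norm_le_pi_norm (X ω) i)
      (abs_nonneg (Lx z.1 (s z.2 ω)))
    linarith [abs_nonneg (Lξ z.1 (s z.2 ω))]
  have hiξ : ∀ ξ, ∀ y ∈ U, Integrable (fun ω => Lξ ξ (s y ω)) μ := by
    intro ξ y hy
    obtain ⟨R, hR, gbd, hgi, hg⟩ := hbd (ξ, y) hy
    refine hgi.mono' (hmξ ξ y hy) ?_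
    filter_upwards [(hg (ξ, y) (Metric.mem_closedBall_self hR.le)).2] with ω hω using hω.1
  have hiG : ∀ ξ, ∀ y ∈ U, ∀ i, Integrable (fun ω => -(X ω i) * Lx ξ (s y ω)) μ := by
    intro ξ y hy i
    obtain ⟨R, hR, gbd, hgi, hg⟩ := hbd (ξ, y) hy
    refine hgi.mono' (hmG ξ y hy i) ?_
    filter_upwards [(hg (ξ, y) (Metric.mem_closedBall_self hR.le)).2] with ω hω using hω.2 i
  have hcat : ∀ᵐ ω ∂μ, ∀ z₀ : ℝ × (Fin d → ℝ), z₀.2 ∈ U →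
      ContinuousAt (fun z : ℝ × (Fin d → ℝ) => (Lξ z.1 (s z.2 ω), Lx z.1 (s z.2 ω))) z₀ := by
    filter_upwards [hC1] with ω hω z₀ hz₀
    exact hω.2.continuousAt ((isOpen_univ.prod hUo).mem_nhds ⟨mem_univ _, hz₀⟩)
  have hcG : ∀ z₀ : ℝ × (Fin d → ℝ), z₀.2 ∈ U →
      ContinuousAt (fun z : ℝ × (Fin d → ℝ) => G z.1 z.2) z₀ := by
    intro z₀ hz₀
    obtain ⟨R, hR, gbd, hgi, hg⟩ := hbd z₀ hz₀
    refine continuousAt_pi.2 fun i => continuousAt_of_dominated (bound := gbd) ?_ ?_ hgi ?_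
    · filter_upwards [Metric.closedBall_mem_nhds z₀ hR] with z hz
      exact hmG _ _ (hg z hz).1 i
    · filter_upwards [Metric.closedBall_mem_nhds z₀ hR] with z hz
      filter_upwards [(hg z hz).2] with ω hω using hω.2 i
    · filter_upwards [hcat] with ω hω
      exact continuousAt_const.mul (hω z₀ hz₀).snd
  -- the subgradient inequality for the expected loss
  have hsub : ∀ ξ, ∀ y ∈ U, ∀ ξ', ∀ y' ∈ U,
      F ξ y + H ξ y * (ξ' - ξ) + T (G ξ y) (y' - y) ≤ F ξ' y' := by
    intro ξ y hy ξ' y' hy'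
    have hT : T (G ξ y) (y' - y) =
        ∫ ω, ∑ i, -(X ω i) * Lx ξ (s y ω) * (y' i - y i) ∂μ := by
      rw [integral_finsetSum _ fun i _ => (hiG ξ y hy i).mul_const _]
      simp_rw [integral_mul_const]
      simp [T, G]
    have hi1 : Integrable (fun ω => L ξ (s y ω)) μ := hLint ξ y fun i => (hy i).le
    have hi2 := (hiξ ξ y hy).mul_const (ξ' - ξ)
    have hi3 : Integrable (fun ω => ∑ i, -(X ω i) * Lx ξ (s y ω) * (y' i - y i)) μ :=
      integrable_finsetSum _ fun i _ => (hiG ξ y hy i).mul_const _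
    have hi12 : Integrable (fun ω => L ξ (s y ω) + Lξ ξ (s y ω) * (ξ' - ξ)) μ := hi1.add hi2
    have hH : H ξ y * (ξ' - ξ) = ∫ ω, Lξ ξ (s y ω) * (ξ' - ξ) ∂μ :=
      (integral_mul_const _ _).symm
    rw [hT, hH, ← integral_add hi1 hi2, ← integral_add hi12 hi3]
    refine integral_mono_ae (hi12.add hi3) (hLint ξ' y' fun i => (hy' i).le) ?_
    filter_upwards [hC1] with ω hω
    have hlin : ∑ i, -(X ω i) * Lx ξ (s y ω) * (y' i - y i) =
        Lx ξ (s y ω) * (s y' ω - s y ω) := by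
      rw [show s y' ω - s y ω = ∑ i, (y i * X ω i - y' i * X ω i) by
        simp only [s, neg_sub_neg, Finset.sum_sub_distrib], Finset.mul_sum]
      exact Finset.sum_congr rfl fun i _ => by ring
    simp only [hlin]
    exact hLconv.add_partialDeriv_le (hω.1 ξ y hy).1 (hω.1 ξ y hy).2 ξ' (s y' ω)
  have hFc : ∀ y ∈ U, ∀ ξ, ContinuousAt (F ξ) y := by
    intro y hy ξ
    refine (hasFDerivAt_of_subgradient (g := fun u => T (G ξ u)) (hUo.mem_nhds hy)
      ?_ ?_).continuousAt
    · intro u hu v hv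
      simpa using hsub ξ u hu ξ v hv
    · exact hTc.continuousAt.comp
        (ContinuousAt.comp (f := fun u => (ξ, u)) (hcG (ξ, y) hy) (by fun_prop))
  have hHc : ∀ y ∈ U, Continuous fun ξ => H ξ y := by
    intro y hy
    refine continuous_iff_continuousAt.2 fun ξ => ?_
    obtain ⟨R, hR, gbd, hgi, hg⟩ := hbd (ξ, y) hy
    have hnear : ∀ᶠ t in nhds ξ, (t, y) ∈ Metric.closedBall (ξ, y) R :=
      (Continuous.continuousAt (f := fun t : ℝ => (t, y)) (by fun_prop)).eventually_mem
        (Metric.closedBall_mem_nhds _ hR)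
    refine continuousAt_of_dominated (bound := gbd) ?_ ?_ hgi ?_
    · exact Filter.Eventually.of_forall fun t => hmξ t y hy
    · filter_upwards [hnear] with t ht
      filter_upwards [(hg _ ht).2] with ω hω using hω.1
    · filter_upwards [hcat] with ω hω
      exact ContinuousAt.comp (f := fun t : ℝ => (t, y)) (hω (ξ, y) hy).fst (by fun_prop)
  have hH0 : ∀ y ∈ U, H (ξstar y) y = 0 := by
    intro y hy
    have hsubξ : ∀ ξ, H ξ y * (ξstar y - ξ) ≤ 0 := fun ξ => by
      have h1 := hsub ξ y hy (ξstar y) y hy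
      have h2 : F (ξstar y) y ≤ F ξ y := (hξstar y hy).1 ξ
      simp only [sub_self, map_zero, add_zero] at h1
      linarith
    refine le_antisymm ?_ ?_
    · refine le_of_tendsto (((hHc y hy).continuousAt (x := ξstar y)).tendsto.mono_left
        (nhdsWithin_le_nhds (s := Iio (ξstar y)))) ?_
      filter_upwards [self_mem_nhdsWithin] with ξ hξ
      exact nonpos_of_mul_nonpos_left (hsubξ ξ) (sub_pos.2 hξ)
    · refine ge_of_tendsto (((hHc y hy).continuousAt (x := ξstar y)).tendsto.mono_left
        (nhdsWithin_le_nhds (s := Ioi (ξstar y)))) ?_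
      filter_upwards [self_mem_nhdsWithin] with ξ hξ
      have hξ' : ξstar y < ξ := hξ
      nlinarith [hsubξ ξ]
  have hξc : ∀ y ∈ U, ContinuousAt ξstar y := fun y hy =>
    continuousAt_argmin_of_subgradient (F := F) (H := H) (hUo.mem_nhds hy)
      (fun u hu ξ ξ' => by simpa using hsub ξ u hu ξ' u hu) (hFc y hy)
      (fun u hu => (hξstar u hu).1) (hξstar y hy).2
  have hGc : ∀ y ∈ U, ContinuousAt (fun u => G (ξstar u) u) y := fun y hy =>
    ContinuousAt.comp (f := fun u => (ξstar u, u)) (hcG (ξstar y, y) hy)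
      ((hξc y hy).prodMk continuousAt_id)
  refine ⟨fun y hy => ?_, fun y hy => (hGc y hy).continuousWithinAt⟩
  refine hasFDerivAt_of_subgradient (g := fun u => T (G (ξstar u) u)) (hUo.mem_nhds hy) ?_
    (hTc.continuousAt.comp (hGc y hy))
  intro u hu v hv
  simpa [hH0 u hu] using hsub (ξstar u) u hu (ξstar v) v hv

end
end

section
/- Let Z be an integrable real random variable whose cumulative distribution function F_Z is continuous and strictly increasing, and let a, b > 0. Then the function ψ(ξ) = E[ a(Z − ξ)₊ + b(Z − ξ)₋ ] is convex and continuously differentiable on ℝ with ψ'(ξ) = −a(1 − F_Z(ξ)) + b F_Z(ξ), and the set of minimizers of ψ is exactly the singleton { VaR_{a/(a+b)}(Z) }. -/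
open scoped BigOperators
open Set MeasureTheory

/-- A function with a subgradient at every point is convex. -/
lemma convexOn_univ_of_subgradient {f D : ℝ → ℝ}
    (h : ∀ x y, D x * (y - x) ≤ f y - f x) : ConvexOn ℝ univ f := by
  refine ⟨convex_univ, fun x _ y _ s t hs ht hst => ?_⟩
  simp only [smul_eq_mul]
  have hx := mul_le_mul_of_nonneg_left (h (s * x + t * y) x) hs
  have hy := mul_le_mul_of_nonneg_left (h (s * x + t * y) y) ht
  obtain rfl : t = 1 - s := by linarith
  linarith

/-- A continuous selection of subgradients is the derivative. -/
lemma hasDerivAt_of_continuous_subgradient {f D : ℝ → ℝ} (hD : Continuous D)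
    (h : ∀ x y, D x * (y - x) ≤ f y - f x) (x : ℝ) : HasDerivAt f (D x) x := by
  rw [hasDerivAt_iff_isLittleO, Asymptotics.isLittleO_iff]
  intro ε hε
  filter_upwards [Metric.tendsto_nhds.1 (hD.tendsto x) ε hε] with y hy
  rw [Real.dist_eq] at hy
  have hlow := h x y
  have hup := h y x
  have hle : |f y - f x - (y - x) * D x| ≤ |(D y - D x) * (y - x)| := by
    rw [abs_of_nonneg (by linarith)]
    exact le_trans (by linarith) (le_abs_self _)
  simp only [smul_eq_mul, Real.norm_eq_abs]
  rw [abs_mul] at hle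
  exact hle.trans (mul_le_mul_of_nonneg_right hy.le (abs_nonneg _))

lemma integrable_pinball {Ω : Type*} [MeasurableSpace Ω] {μ : Measure Ω} [IsFiniteMeasure μ]
    {Z : Ω → ℝ} (hZ : Integrable Z μ) (a c ξ : ℝ) :
    Integrable (fun ω => a * max (Z ω - ξ) 0 + c * max (ξ - Z ω) 0) μ :=
  ((hZ.sub (integrable_const ξ)).pos_part.const_mul a).add
    (((integrable_const ξ).sub hZ).pos_part.const_mul c)

lemma pinball_subgradient {a c : ℝ} (ha : 0 ≤ a) (hc : 0 ≤ c) (z ξ η : ℝ) :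
    ((if z ≤ ξ then a + c else 0) - a) * (η - ξ) ≤
      (a * max (z - η) 0 + c * max (η - z) 0) - (a * max (z - ξ) 0 + c * max (ξ - z) 0) := by
  have h₁ := mul_le_mul_of_nonneg_left (le_max_left (z - η) 0) ha
  have h₂ := mul_le_mul_of_nonneg_left (le_max_right (z - η) 0) ha
  have h₃ := mul_le_mul_of_nonneg_left (le_max_left (η - z) 0) hc
  have h₄ := mul_le_mul_of_nonneg_left (le_max_right (η - z) 0) hc
  split_ifs with h
  · rw [max_eq_right (sub_nonpos.2 h), max_eq_left (sub_nonneg.2 h)]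
    linarith
  · rw [max_eq_left (sub_nonneg.2 (not_le.1 h).le), max_eq_right (sub_nonpos.2 (not_le.1 h).le)]
    linarith

lemma integral_pinball_subgradient {Ω : Type*} [MeasurableSpace Ω] {μ : Measure Ω}
    [IsProbabilityMeasure μ] {Z : Ω → ℝ} (hZmeas : Measurable Z) (hZ : Integrable Z μ)
    {a c : ℝ} (ha : 0 ≤ a) (hc : 0 ≤ c) (ξ η : ℝ) :
    (-a * (1 - μ.real {ω | Z ω ≤ ξ}) + c * μ.real {ω | Z ω ≤ ξ}) * (η - ξ) ≤
      (∫ ω, (a * max (Z ω - η) 0 + c * max (η - Z ω) 0) ∂μ) -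
        ∫ ω, (a * max (Z ω - ξ) 0 + c * max (ξ - Z ω) 0) ∂μ := by
  have hs : MeasurableSet {ω | Z ω ≤ ξ} := measurableSet_le hZmeas measurable_const
  have hind : (fun ω => if Z ω ≤ ξ then a + c else 0) =
      {ω | Z ω ≤ ξ}.indicator fun _ => a + c := by
    ext ω
    simp [indicator_apply]
  have hint : Integrable (fun ω => if Z ω ≤ ξ then a + c else 0) μ := by
    rw [hind]
    exact (integrable_const _).indicator hs
  have hval : ∫ ω, ((if Z ω ≤ ξ then a + c else 0) - a) * (η - ξ) ∂μ =
      (-a * (1 - μ.real {ω | Z ω ≤ ξ}) + c * μ.real {ω | Z ω ≤ ξ}) * (η - ξ) := by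
    rw [integral_mul_const, integral_sub hint (integrable_const a), hind,
      integral_indicator_const _ hs]
    simp only [integral_const, probReal_univ, smul_eq_mul]
    ring
  rw [← hval, ← integral_sub (integrable_pinball hZ a c η) (integrable_pinball hZ a c ξ)]
  exact integral_mono ((hint.sub (integrable_const a)).mul_const _)
    ((integrable_pinball hZ a c η).sub (integrable_pinball hZ a c ξ))
    fun ω => pinball_subgradient ha hc (Z ω) ξ η

/-- A continuous distribution function attains every level in `(0, 1)`. -/
lemma exists_measureReal_le_eq {Ω : Type*} [MeasurableSpace Ω] {μ : Measure Ω}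
    [IsProbabilityMeasure μ] {Z : Ω → ℝ} (hZ : Measurable Z)
    (hcont : Continuous fun ξ => μ.real {ω | Z ω ≤ ξ}) {p : ℝ} (hp₀ : 0 < p) (hp₁ : p < 1) :
    ∃ ξ, μ.real {ω | Z ω ≤ ξ} = p := by
  have := Measure.isProbabilityMeasure_map (μ := μ) hZ.aemeasurable
  have hcdf : (fun ξ => μ.real {ω | Z ω ≤ ξ}) = ProbabilityTheory.cdf (μ.map Z) := by
    ext ξ
    rw [ProbabilityTheory.cdf_eq_real, map_measureReal_apply hZ measurableSet_Iic]
    rfl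
  obtain ⟨x, hx⟩ := ((hcdf ▸ ProbabilityTheory.tendsto_cdf_atBot (μ.map Z)).eventually
    (gt_mem_nhds hp₀)).exists
  obtain ⟨y, hy⟩ := ((hcdf ▸ ProbabilityTheory.tendsto_cdf_atTop (μ.map Z)).eventually
    (lt_mem_nhds hp₁)).exists
  exact mem_range_of_exists_le_of_exists_ge hcont ⟨x, hx.le⟩ ⟨y, hy.le⟩

/-- For an integrable random variable `Z` with continuous and strictly
increasing cdf `F_Z`, and `a, c > 0`, the function
`ψ(ξ) = E[a (Z-ξ)₊ + c (Z-ξ)₋]` is convex and continuously differentiable with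
`ψ'(ξ) = -a (1 - F_Z(ξ)) + c F_Z(ξ)`, and its set of minimizers is exactly
`{VaR_{a/(a+c)}(Z)}`, where `VaR_α(Z) = inf {ξ | ℙ(Z ≤ ξ) ≥ α}`. -/
theorem pinball_minimizer_is_VaR
    {Ω : Type*} [MeasurableSpace Ω] (μ : Measure Ω) [IsProbabilityMeasure μ]
    (Z : Ω → ℝ) (hZmeas : Measurable Z) (hZint : Integrable Z μ)
    (a c : ℝ) (ha : 0 < a) (hc : 0 < c)
    (F : ℝ → ℝ) (hF : F = fun ξ => (μ {ω | Z ω ≤ ξ}).toReal)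
    (hFcont : Continuous F) (hFmono : StrictMono F) :
    ConvexOn ℝ Set.univ
      (fun ξ => ∫ ω, (a * max (Z ω - ξ) 0 + c * max (ξ - Z ω) 0) ∂μ) ∧
    (∀ ξ : ℝ, HasDerivAt
      (fun ξ => ∫ ω, (a * max (Z ω - ξ) 0 + c * max (ξ - Z ω) 0) ∂μ)
      (-a * (1 - F ξ) + c * F ξ) ξ) ∧
    {ξ : ℝ | ∀ ξ' : ℝ, (∫ ω, (a * max (Z ω - ξ) 0 + c * max (ξ - Z ω) 0) ∂μ) ≤
        ∫ ω, (a * max (Z ω - ξ') 0 + c * max (ξ' - Z ω) 0) ∂μ} =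
      {sInf {ξ : ℝ | a / (a + c) ≤ F ξ}} := by
  have hFreal : ∀ ξ, F ξ = μ.real {ω | Z ω ≤ ξ} := fun ξ => by rw [hF]; rfl
  have hsub : ∀ ξ η, (-a * (1 - F ξ) + c * F ξ) * (η - ξ) ≤
      (∫ ω, (a * max (Z ω - η) 0 + c * max (η - Z ω) 0) ∂μ) -
        ∫ ω, (a * max (Z ω - ξ) 0 + c * max (ξ - Z ω) 0) ∂μ := fun ξ η => by
    rw [hFreal]
    exact integral_pinball_subgradient hZmeas hZint ha.le hc.le ξ η
  have hderiv := hasDerivAt_of_continuous_subgradient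
    (f := fun ξ => ∫ ω, (a * max (Z ω - ξ) 0 + c * max (ξ - Z ω) 0) ∂μ)
    (D := fun ξ => -a * (1 - F ξ) + c * F ξ) (by fun_prop) hsub
  refine ⟨convexOn_univ_of_subgradient hsub, hderiv, ?_⟩
  have hac : 0 < a + c := add_pos ha hc
  obtain ⟨q, hq⟩ : ∃ q, F q = a / (a + c) := by
    simp only [hFreal]
    exact exists_measureReal_le_eq hZmeas (by simpa only [← hFreal] using hFcont)
      (div_pos ha hac) ((div_lt_one hac).2 (by linarith))
  have hVaR : sInf {ξ : ℝ | a / (a + c) ≤ F ξ} = q := by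
    have : {ξ : ℝ | a / (a + c) ≤ F ξ} = Ici q := by
      ext ξ
      rw [mem_ofPred_eq, ← hq, hFmono.le_iff_le, mem_Ici]
    rw [this, csInf_Ici]
  rw [hVaR]
  ext ξ
  rw [mem_ofPred_eq, mem_singleton_iff]
  constructor
  · intro hmin
    have hzero := IsLocalMin.hasDerivAt_eq_zero (Filter.Eventually.of_forall hmin) (hderiv ξ)
    refine hFmono.injective ?_
    rw [hq, eq_div_iff hac.ne']
    linarith
  · rintro rfl η
    have hzero : -a * (1 - F ξ) + c * F ξ = 0 := by
      rw [hq]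
      field_simp
      ring
    have := hsub ξ η
    rw [hzero, zero_mul] at this
    linarith
end
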